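/- arXiv:2205.14431 — 2 statements merged into one kernel-verified Lean document; each statement's English description precedes it below -/
import Mathlib

section
/- Let N > 1 be an integer, α > 0, and b = 0. For every c > 0 the translating-profile problem has a unique solution Φ(·; c, 0), it is defined on all of [0, ∞), it is C^∞ on [0, ∞), it satisfies Φ'(r) > 0 and Φ''(r) > 0 for all r > 0, and Φ(r)/r^{α+1} → c/((α+1)(N−1)^α) as r → ∞. -/
open Set Filter Topology

/-- Signed power: the usual real power for nonnegative arguments, extended oddly
to negative arguments (matching `x^{e}` for `1/e = p/q` with `p, q` odd). -/
noncomputable def oddPow (x e : ℝ) : ℝ := if 0 ≤ x then x ^ e else -((-x) ^ e)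

/-- `φ`, with first derivative `φ'` and second derivative `φ''`, solves the
translating-profile equation
`φ''/(1+φ'²) + ((N−1)/r)·φ' = (c/√(1+φ'²) − b)^{1/α}·√(1+φ'²)` for `r ∈ J`, `r ≠ 0`,
with the initial conditions `φ(0) = φ'(0) = 0`. -/
def IsProfileSolOn (N : ℕ) (α b c : ℝ) (J : Set ℝ) (φ φ' φ'' : ℝ → ℝ) : Prop :=
  φ 0 = 0 ∧ φ' 0 = 0 ∧
  (∀ r ∈ J, HasDerivWithinAt φ (φ' r) J r) ∧
  (∀ r ∈ J, HasDerivWithinAt φ' (φ'' r) J r) ∧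
  (∀ r ∈ J, r ≠ 0 →
    φ'' r / (1 + φ' r ^ 2) + (((N : ℝ) - 1) / r) * φ' r
      = oddPow (c / Real.sqrt (1 + φ' r ^ 2) - b) (1 / α) * Real.sqrt (1 + φ' r ^ 2))

/-- `φ` is the unique solution of the translating-profile problem, defined on its
maximal existence interval `[0, R)`: it is a solution there, and any solution on any
interval `[0, S)` satisfies `S ≤ R` and coincides with `φ` on `[0, S)`. -/
def IsMaxProfileSol (N : ℕ) (α b c R : ℝ) (φ φ' φ'' : ℝ → ℝ) : Prop :=
  0 < R ∧ IsProfileSolOn N α b c (Set.Ico 0 R) φ φ' φ'' ∧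
  ∀ S ψ ψ' ψ'', 0 < S → IsProfileSolOn N α b c (Set.Ico 0 S) ψ ψ' ψ'' →
    S ≤ R ∧ Set.EqOn ψ φ (Set.Ico 0 S)


/-- weighted average operator -/
noncomputable def avgOp (n : ℕ) (g : ℝ → ℝ) (r : ℝ) : ℝ := ∫ t in (0:ℝ)..1, t ^ n * g (r * t)

theorem avgOp_continuous (n : ℕ) {g : ℝ → ℝ} (hg : Continuous g) : Continuous (avgOp n g) := by
  unfold avgOp
  apply intervalIntegral.continuous_parametric_intervalIntegral_of_continuous'
  fun_prop

theorem avgOp_zero (n : ℕ) (g : ℝ → ℝ) : avgOp n g 0 = g 0 / (n + 1) := by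
  unfold avgOp
  simp [integral_pow]
  ring

theorem avgOp_mul (n : ℕ) (g : ℝ → ℝ) (r : ℝ) :
    r ^ (n + 1) * avgOp n g r = ∫ s in (0:ℝ)..r, s ^ n * g s := by
  have h := intervalIntegral.mul_integral_comp_mul_left (a := 0) (b := 1)
    (f := fun s : ℝ => s ^ n * g s) (c := r)
  simp only [mul_zero, mul_one] at h
  rw [← h, pow_succ']
  unfold avgOp
  rw [mul_assoc, ← intervalIntegral.integral_const_mul]
  congr 1
  apply intervalIntegral.integral_congr
  intro t _
  simp only [mul_pow]
  ring

theorem mul_avgOp_hasDerivAt (n : ℕ) {g : ℝ → ℝ} (hg : Continuous g) (r : ℝ) :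
    HasDerivAt (fun s => s * avgOp n g s) (g r - n * avgOp n g r) r := by
  by_cases hr : r = 0
  · subst hr
    rw [hasDerivAt_iff_tendsto_slope]
    have h1 : g 0 - n * avgOp n g 0 = avgOp n g 0 := by
      rw [avgOp_zero]
      have : (n:ℝ) + 1 ≠ 0 := by positivity
      field_simp
      ring
    rw [h1]
    have h2 : Tendsto (avgOp n g) (𝓝[≠] 0) (𝓝 (avgOp n g 0)) :=
      ((avgOp_continuous n hg).tendsto 0).mono_left nhdsWithin_le_nhds
    refine h2.congr' ?_
    filter_upwards [self_mem_nhdsWithin] with s hs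
    have hs' : s ≠ 0 := hs
    simp [slope, hs']
  · have hI : HasDerivAt (fun x => ∫ s in (0:ℝ)..x, s ^ n * g s) (r ^ n * g r) r := by
      apply intervalIntegral.integral_hasDerivAt_right
      · exact Continuous.intervalIntegrable (by fun_prop) _ _
      · exact (Continuous.stronglyMeasurable (by fun_prop)).stronglyMeasurableAtFilter
      · exact Continuous.continuousAt (by fun_prop)
    have hp : r ^ n ≠ 0 := pow_ne_zero _ hr
    have h3 := hI.div (hasDerivAt_pow n r) hp
    have h4 : (fun s => s * avgOp n g s) =ᶠ[𝓝 r]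
        (fun x => (∫ s in (0:ℝ)..x, s ^ n * g s) / x ^ n) := by
      filter_upwards [isOpen_ne.mem_nhds hr] with s hs
      have hs' : s ≠ 0 := hs
      rw [← avgOp_mul]
      field_simp
      ring
    refine (h3.congr_of_eventuallyEq h4).congr_deriv ?_
    rw [← avgOp_mul]
    rcases n with _ | n
    · simp
    · simp only [Nat.add_sub_cancel]
      field_simp
      ring

theorem avgOp_hasDerivAt (n : ℕ) {g : ℝ → ℝ} (hg : ContDiff ℝ 1 g) (r : ℝ) :
    HasDerivAt (avgOp n g) (avgOp (n + 1) (deriv g) r) r := by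
  have hd : Continuous (deriv g) := hg.continuous_deriv le_rfl
  obtain ⟨C, hC⟩ := (isCompact_closedBall (0:ℝ) (|r| + 1)).exists_bound_of_continuousOn
    hd.continuousOn
  have key := intervalIntegral.hasDerivAt_integral_of_dominated_loc_of_deriv_le
    (μ := MeasureTheory.volume) (a := 0) (b := 1) (𝕜 := ℝ)
    (F := fun r t => t ^ n * g (r * t)) (F' := fun r t => t ^ (n+1) * deriv g (r * t))
    (x₀ := r) (s := Metric.ball r 1) (bound := fun _ => C)
    (Metric.ball_mem_nhds _ one_pos) ?_ ?_ ?_ ?_ ?_ ?_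
  · exact key.2
  · have := hg.continuous
    exact Filter.Eventually.of_forall fun x =>
      Continuous.aestronglyMeasurable (by fun_prop)
  · have := hg.continuous
    exact Continuous.intervalIntegrable (by fun_prop) _ _
  · exact Continuous.aestronglyMeasurable (by fun_prop)
  · refine Filter.Eventually.of_forall fun t ht x hx => ?_
    rw [uIoc_of_le zero_le_one] at ht
    have hx' : |x - r| < 1 := by simpa [Real.dist_eq] using hx
    have h1 : |x| ≤ |r| + 1 := by
      have := abs_sub_abs_le_abs_sub x r
      linarith
    have h2 : ‖deriv g (x * t)‖ ≤ C := by
      apply hC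
      simp only [Metric.mem_closedBall, dist_zero_right, Real.norm_eq_abs, abs_mul]
      rw [abs_of_pos ht.1]
      nlinarith [abs_nonneg x, ht.2, ht.1]
    rw [norm_mul]
    have h3 : ‖t ^ (n+1)‖ ≤ 1 := by
      rw [norm_pow, Real.norm_eq_abs, abs_of_pos ht.1]
      exact pow_le_one₀ ht.1.le ht.2
    nlinarith [norm_nonneg (deriv g (x * t)), norm_nonneg (t ^ (n+1))]
  · simp
  · refine Filter.Eventually.of_forall fun t _ x _ => ?_
    have h1 : HasDerivAt g (deriv g (x * t)) (x * t) :=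
      (hg.differentiable one_ne_zero (x * t)).hasDerivAt
    have h2 : HasDerivAt (fun x => x * t) t x := by
      simpa using (hasDerivAt_id x).mul_const t
    have h3 := (h1.comp x h2).const_mul (t ^ n)
    refine h3.congr_deriv ?_
    ring

theorem avgOp_contDiff (k : ℕ) : ∀ (n : ℕ) {g : ℝ → ℝ}, ContDiff ℝ k g →
    ContDiff ℝ k (avgOp n g) := by
  induction k with
  | zero =>
    intro n g hg
    have hg' : Continuous g := hg.continuous
    exact contDiff_zero.2 (avgOp_continuous n hg')
  | succ k ih =>
    intro n g hg
    have h1 : ContDiff ℝ 1 g := hg.of_le (by norm_cast; omega)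
    have hder : deriv (avgOp n g) = avgOp (n+1) (deriv g) :=
      funext fun r => (avgOp_hasDerivAt n h1 r).deriv
    push_cast at hg ⊢
    rw [contDiff_succ_iff_deriv] at hg ⊢
    refine ⟨fun r => (avgOp_hasDerivAt n h1 r).differentiableAt, by simp, ?_⟩
    rw [hder]
    exact ih _ hg.2.2

theorem avgOp_abs_le (n : ℕ) {g : ℝ → ℝ} {K : ℝ} (hK : ∀ x, |g x| ≤ K) (r : ℝ) :
    |avgOp n g r| ≤ K := by
  unfold avgOp
  have h := intervalIntegral.norm_integral_le_of_norm_le_const (a := 0) (b := 1) (C := K)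
    (f := fun t : ℝ => t ^ n * g (r * t)) (fun t ht => by
      rw [uIoc_of_le zero_le_one] at ht
      rw [norm_mul, norm_pow, Real.norm_eq_abs, Real.norm_eq_abs, abs_of_pos ht.1]
      have h3 : t ^ n ≤ 1 := pow_le_one₀ ht.1.le ht.2
      have h4 := hK (r * t)
      have h5 : 0 ≤ t ^ n := pow_nonneg ht.1.le _
      nlinarith [abs_nonneg (g (r * t))])
  simpa using h

theorem weighted_bound (l x : ℝ) (hl : 1 ≤ l) (hx : 0 ≤ x) : Real.exp (-(l * x)) * x ≤ 1 := by
  rw [Real.exp_neg, inv_mul_le_iff₀ (Real.exp_pos _)]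
  have := Real.add_one_le_exp (l * x)
  nlinarith

theorem exists_fixed (n : ℕ) (F : ℝ → ℝ) (L : NNReal) (hF : LipschitzWith L F) (K : ℝ)
    (hK : ∀ x, |F x| ≤ K) :
    ∃ u : ℝ → ℝ, Continuous u ∧ ∀ r, u r = r * avgOp n (fun s => F (u s)) r := by
  set l : ℝ := L + 1 with hl
  have hl1 : 1 ≤ l := by simp [hl]
  have hFc : Continuous F := hF.continuous
  have hcont : ∀ y : ℝ → ℝ, Continuous y →
      Continuous (fun s => F (Real.exp (l * |s|) * y s)) := by
    intro y hy
    fun_prop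
  let A : BoundedContinuousFunction ℝ ℝ → BoundedContinuousFunction ℝ ℝ := fun y =>
    BoundedContinuousFunction.ofNormedAddCommGroup
      (fun r => Real.exp (-(l * |r|)) * (r * avgOp n (fun s => F (Real.exp (l * |s|) * y s)) r))
      (by
        have := avgOp_continuous n (hcont y y.continuous)
        fun_prop) K (by
        intro r
        have h1 := avgOp_abs_le n (g := fun s => F (Real.exp (l * |s|) * y s)) (fun x => hK _) r
        have h2 := weighted_bound l |r| hl1 (abs_nonneg r)
        rw [norm_mul, norm_mul, Real.norm_eq_abs, Real.norm_eq_abs, Real.norm_eq_abs,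
          abs_of_pos (Real.exp_pos _), ← mul_assoc]
        have h3 : 0 ≤ Real.exp (-(l * |r|)) * |r| := by positivity
        have h4 := abs_nonneg (avgOp n (fun s => F (Real.exp (l * |s|) * y s)) r)
        nlinarith)
  have hA : ∀ y r, A y r =
    Real.exp (-(l * |r|)) * (r * avgOp n (fun s => F (Real.exp (l * |s|) * y s)) r) :=
    fun y r => rfl
  have hq1 : (L / (L + 1) : NNReal) < 1 := by
    rw [div_lt_one (by positivity)]
    exact lt_add_one L
  have hcon : ContractingWith (L / (L + 1)) A := by
    refine ⟨hq1, LipschitzWith.of_dist_le_mul fun y z => ?_⟩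
    have hD : 0 ≤ dist y z := dist_nonneg
    rw [BoundedContinuousFunction.dist_le (by positivity)]
    intro r
    rw [hA, hA, Real.dist_eq, ← mul_sub, ← mul_sub, abs_mul, abs_mul,
      abs_of_pos (Real.exp_pos _)]
    have hi : ∀ y : BoundedContinuousFunction ℝ ℝ, IntervalIntegrable
        (fun t => t ^ n * F (Real.exp (l * |r * t|) * y (r * t))) MeasureTheory.volume 0 1 := by
      intro y
      have := y.continuous
      exact Continuous.intervalIntegrable (by fun_prop) _ _
    have hdiff : |avgOp n (fun s => F (Real.exp (l * |s|) * y s)) r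
        - avgOp n (fun s => F (Real.exp (l * |s|) * z s)) r|
        ≤ L * dist y z * ∫ t in (0:ℝ)..1, Real.exp (l * |r| * t) := by
      unfold avgOp
      rw [← intervalIntegral.integral_sub (hi y) (hi z),
        ← intervalIntegral.integral_const_mul]
      rw [← Real.norm_eq_abs]
      apply intervalIntegral.norm_integral_le_of_norm_le zero_le_one
      · refine Filter.Eventually.of_forall fun t ht => ?_
        have h8 : l * |r * t| = l * |r| * t := by
          rw [abs_mul, abs_of_pos ht.1]
          ring
        rw [h8, ← mul_sub, norm_mul, norm_pow, Real.norm_eq_abs, abs_of_pos ht.1]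
        have h3 : t ^ n ≤ 1 := pow_le_one₀ ht.1.le ht.2
        have h5 : 0 ≤ t ^ n := pow_nonneg ht.1.le _
        have h6 := hF.dist_le_mul (Real.exp (l * |r * t|) * y (r * t))
          (Real.exp (l * |r * t|) * z (r * t))
        rw [h8, dist_eq_norm, Real.dist_eq, ← mul_sub, abs_mul, abs_of_pos (Real.exp_pos _),
          ← Real.dist_eq] at h6
        have h7 : dist (y (r * t)) (z (r * t)) ≤ dist y z :=
          BoundedContinuousFunction.dist_coe_le_dist _
        calc _ ≤ 1 * (L * (Real.exp (l * |r| * t) * dist (y (r * t)) (z (r * t)))) := by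
              gcongr
          _ ≤ 1 * (L * (Real.exp (l * |r| * t) * dist y z)) := by gcongr
          _ = _ := by ring
      · exact Continuous.intervalIntegrable (by fun_prop) _ _
    have hexp : (l * |r|) * ∫ t in (0:ℝ)..1, Real.exp (l * |r| * t)
        = Real.exp (l * |r|) - 1 := by
      have h := intervalIntegral.mul_integral_comp_mul_left (a := 0) (b := 1)
        (f := Real.exp) (c := l * |r|)
      rw [h]
      simp
    set I := ∫ t in (0:ℝ)..1, Real.exp (l * |r| * t)
    have hl0 : 0 < l := by linarith
    have hrI : |r| * I = (Real.exp (l * |r|) - 1) / l := by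
      rw [← hexp]
      field_simp
    have hcast : ((L / (L + 1) : NNReal) : ℝ) = L / l := by
      simp [hl]
    rw [hcast]
    calc _ ≤ Real.exp (-(l * |r|)) * (|r| * (L * dist y z * I)) := by gcongr
      _ = Real.exp (-(l * |r|)) * (|r| * I) * (L * dist y z) := by ring
      _ = (1 - Real.exp (-(l * |r|))) * (L / l * dist y z) := by
        rw [hrI, Real.exp_neg]
        field_simp
      _ ≤ 1 * (L / l * dist y z) := by
        gcongr
        linarith [Real.exp_pos (-(l * |r|))]
      _ = _ := one_mul _
  have hfix := hcon.fixedPoint_isFixedPt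
  set y := hcon.fixedPoint A with hy
  refine ⟨fun s => Real.exp (l * |s|) * y s, ?_, ?_⟩
  · have := y.continuous
    fun_prop
  · intro r
    have h1 : y r = A y r := by
      conv_lhs => rw [← hfix]
    simp only
    conv_lhs => rw [h1, hA]
    rw [← mul_assoc, ← Real.exp_add]
    simp

/-- the nonlinearity for the sine of the slope angle -/
noncomputable def fP (K β x : ℝ) : ℝ := K * (1 - x ^ 2) ^ β

theorem fP_cont (K : ℝ) {β : ℝ} (hβ : 0 < β) : Continuous (fP K β) := by
  unfold fP
  exact continuous_const.mul
    (Continuous.rpow_const (by fun_prop) (fun x => Or.inr hβ.le))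

theorem one_sub_sq_pos {x : ℝ} (hx : |x| < 1) : 0 < 1 - x ^ 2 := by
  have := (sq_lt_one_iff_abs_lt_one x).2 hx
  linarith

theorem fP_pos {K β x : ℝ} (hK : 0 < K) (hx : |x| < 1) : 0 < fP K β x :=
  mul_pos hK (Real.rpow_pos_of_pos (one_sub_sq_pos hx) _)

theorem fP_anti {K β x y : ℝ} (hK : 0 < K) (hβ : 0 < β) (hx : 0 ≤ x) (hxy : x ≤ y) (hy : y ≤ 1) :
    fP K β y ≤ fP K β x := by
  unfold fP
  have : 0 ≤ 1 - y ^ 2 := by nlinarith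
  gcongr

theorem fP_neg (K β x : ℝ) : fP K β (-x) = fP K β x := by
  simp [fP]

theorem fP_contDiffAt (K β : ℝ) {x : ℝ} (hx : |x| < 1) {m : WithTop ℕ∞} :
    ContDiffAt ℝ m (fP K β) x := by
  unfold fP
  exact contDiffAt_const.mul (ContDiffAt.rpow_const_of_ne (by fun_prop) (one_sub_sq_pos hx).ne')

/-- the first-order profile problem -/
def IsU (n : ℕ) (K β S : ℝ) (u : ℝ → ℝ) : Prop :=
  ContinuousOn u (Ico 0 S) ∧ u 0 = 0 ∧
    ∀ r ∈ Ioo 0 S, |u r| < 1 ∧ HasDerivAt u (fP K β (u r) - n * u r / r) r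

theorem IsU.mono {n : ℕ} {K β S S' : ℝ} {u : ℝ → ℝ} (h : IsU n K β S u) (hS : S' ≤ S) :
    IsU n K β S' u :=
  ⟨h.1.mono (Ico_subset_Ico_right hS), h.2.1,
    fun r hr => h.2.2 r (Ioo_subset_Ioo_right hS hr)⟩

theorem IsU.nonneg {n : ℕ} (hn : 1 ≤ n) {K β S : ℝ} (hK : 0 < K) {u : ℝ → ℝ}
    (h : IsU n K β S u) : ∀ r ∈ Ico 0 S, 0 ≤ u r := by
  obtain ⟨hc, h0, hd⟩ := h
  have hder : ∀ r ∈ Ioo 0 S, HasDerivAt (fun r => r ^ n * u r) (r ^ n * fP K β (u r)) r := by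
    intro r hr
    have h1 := (hasDerivAt_pow n r).mul (hd r hr).2
    refine h1.congr_deriv ?_
    have hr0 : r ≠ 0 := hr.1.ne'
    obtain ⟨m, rfl⟩ : ∃ m, n = m + 1 := ⟨n - 1, by omega⟩
    simp only [Nat.add_sub_cancel]
    field_simp
    ring
  have hm : MonotoneOn (fun r => r ^ n * u r) (Ico 0 S) := by
    apply monotoneOn_of_deriv_nonneg (convex_Ico 0 S)
    · exact (by fun_prop : Continuous fun r : ℝ => r ^ n).continuousOn.mul hc
    · intro r hr
      rw [interior_Ico] at hr
      exact (hder r hr).differentiableAt.differentiableWithinAt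
    · intro r hr
      rw [interior_Ico] at hr
      rw [(hder r hr).deriv]
      exact mul_nonneg (pow_nonneg hr.1.le _) (fP_pos hK (hd r hr).1).le
  intro r hr
  rcases hr.1.eq_or_lt with h | h
  · rw [← h, h0]
  · have := hm (left_mem_Ico.2 (hr.1.trans_lt hr.2)) hr hr.1
    simp only [h0, mul_zero] at this
    exact nonneg_of_mul_nonneg_right this (pow_pos h n)

theorem IsU.unique {n : ℕ} (hn : 1 ≤ n) {K β S : ℝ} (hK : 0 < K) (hβ : 0 < β) {u v : ℝ → ℝ}
    (hu : IsU n K β S u) (hv : IsU n K β S v) : EqOn u v (Ico 0 S) := by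
  have hu0 := hu.nonneg hn hK
  have hv0 := hv.nonneg hn hK
  obtain ⟨hc, h0, hd⟩ := hu
  obtain ⟨hc', h0', hd'⟩ := hv
  have hder : ∀ r ∈ Ioo 0 S, HasDerivAt (fun r => (r ^ n * (u r - v r)) ^ 2)
      (2 * (r ^ n) ^ 2 * ((u r - v r) * (fP K β (u r) - fP K β (v r)))) r := by
    intro r hr
    have h1 := ((hasDerivAt_pow n r).mul ((hd r hr).2.sub (hd' r hr).2)).pow 2
    refine h1.congr_deriv ?_
    have hr0 : r ≠ 0 := hr.1.ne'
    obtain ⟨m, rfl⟩ : ∃ m, n = m + 1 := ⟨n - 1, by omega⟩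
    simp only [Nat.add_sub_cancel, Pi.mul_apply, Pi.sub_apply]
    field_simp
    push_cast
    ring
  have hm : AntitoneOn (fun r => (r ^ n * (u r - v r)) ^ 2) (Ico 0 S) := by
    apply antitoneOn_of_deriv_nonpos (convex_Ico 0 S)
    · exact ((by fun_prop : Continuous fun r : ℝ => r ^ n).continuousOn.mul (hc.sub hc')).pow 2
    · intro r hr
      rw [interior_Ico] at hr
      exact (hder r hr).differentiableAt.differentiableWithinAt
    · intro r hr
      rw [interior_Ico] at hr
      rw [(hder r hr).deriv]
      have hr' := Ioo_subset_Ico_self hr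
      have hu1 := (abs_lt.1 (hd r hr).1).2
      have hv1 := (abs_lt.1 (hd' r hr).1).2
      apply mul_nonpos_of_nonneg_of_nonpos (by positivity)
      rcases le_total (u r) (v r) with h | h
      · exact mul_nonpos_of_nonpos_of_nonneg (by linarith)
          (by linarith [fP_anti hK hβ (hu0 r hr') h hv1.le])
      · exact mul_nonpos_of_nonneg_of_nonpos (by linarith)
          (by linarith [fP_anti hK hβ (hv0 r hr') h hu1.le])
  intro r hr
  rcases hr.1.eq_or_lt with h | h
  · rw [← h, h0, h0']
  · have := hm (left_mem_Ico.2 (hr.1.trans_lt hr.2)) hr hr.1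
    simp only [h0, h0', sub_self, mul_zero] at this
    have h2 : (r ^ n * (u r - v r)) ^ 2 = 0 := le_antisymm (by simpa using this) (sq_nonneg _)
    have h3 := (mul_eq_zero.1 (pow_eq_zero_iff two_ne_zero |>.1 h2)).resolve_left
      (pow_pos h n).ne'
    linarith

theorem exists_barrier (n : ℕ) (hn : 1 ≤ n) {K β R : ℝ} (hβ : 0 < β) (hR : 0 < R) :
    ∃ a, 0 < a ∧ a < 1 ∧ fP K β a < n * a / R := by
  have hc : Continuous fun a : ℝ => n * a / R - fP K β a :=
    by have := fP_cont K hβ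
       fun_prop
  have h1 : 0 < (fun a : ℝ => n * a / R - fP K β a) 1 := by
    have : (0:ℝ) < n := by exact_mod_cast hn
    simp only [fP]
    rw [one_pow, sub_self, Real.zero_rpow hβ.ne']
    simp
    positivity
  have h2 : ∀ᶠ a in 𝓝[<] (1:ℝ), 0 < (fun a : ℝ => n * a / R - fP K β a) a :=
    (hc.continuousAt.eventually (lt_mem_nhds h1)).filter_mono nhdsWithin_le_nhds
  have h3 : ∀ᶠ a in 𝓝[<] (1:ℝ), a ∈ Ioo (0:ℝ) 1 := Ioo_mem_nhdsLT one_pos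
  obtain ⟨a, ha, hb⟩ := (h2.and h3).exists
  exact ⟨a, hb.1, hb.2, by simpa using ha⟩

theorem exists_local (n : ℕ) (hn : 1 ≤ n) {K β : ℝ} (hK : 0 < K) (hβ : 0 < β) (R : ℝ)
    (hR : 0 < R) :
    ∃ u : ℝ → ℝ, Continuous u ∧ IsU n K β R u ∧ (∀ r ∈ Icc 0 R, |u r| < 1) ∧
      ∀ r ∈ Icc 0 R, u r = r * avgOp n (fun s => fP K β (u s)) r := by
  obtain ⟨a, ha0, ha1, hab⟩ := exists_barrier n hn (K := K) hβ hR
  obtain ⟨L, hL⟩ : ∃ L, LipschitzOnWith L (fP K β) (Icc 0 a) := by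
    refine ContDiffOn.exists_lipschitzOnWith (n := 1) (fun x hx => ?_) one_ne_zero
      (convex_Icc 0 a) isCompact_Icc
    apply (fP_contDiffAt K β _).contDiffWithinAt
    rw [abs_of_nonneg hx.1]
    linarith [hx.2]
  let F : ℝ → ℝ := fun x => fP K β (projIcc 0 a ha0.le x)
  have hFL : LipschitzWith L F := by
    have h1 : LipschitzWith 1 (projIcc 0 a ha0.le) := LipschitzWith.projIcc ha0.le
    have h2 := hL.to_restrict.comp h1
    rw [mul_one] at h2
    exact h2
  have hFnn : ∀ x, 0 ≤ F x ∧ F x ≤ K := by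
    intro x
    have hm := (projIcc 0 a ha0.le x).2
    refine ⟨(fP_pos hK ?_).le, ?_⟩
    · rw [abs_of_nonneg hm.1]
      linarith [hm.2]
    · have h := fP_anti hK hβ le_rfl hm.1 (hm.2.trans ha1.le)
      have h0 : fP K β 0 = K := by simp [fP]
      rwa [h0] at h
  obtain ⟨u, huc, hu⟩ := exists_fixed n F L hFL K
    (fun x => by rw [abs_of_nonneg (hFnn x).1]; exact (hFnn x).2)
  have hgc : Continuous (fun s => F (u s)) := hFL.continuous.comp huc
  have hder : ∀ r, HasDerivAt u (F (u r) - n * avgOp n (fun s => F (u s)) r) r := by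
    intro r
    have h := mul_avgOp_hasDerivAt n hgc r
    exact h.congr_of_eventuallyEq (Filter.Eventually.of_forall hu)
  have hu0 : u 0 = 0 := by rw [hu 0]; simp
  have hnn : ∀ r, 0 ≤ r → 0 ≤ u r := by
    intro r hr
    rw [hu r]
    apply mul_nonneg hr
    unfold avgOp
    apply intervalIntegral.integral_nonneg zero_le_one
    intro t ht
    exact mul_nonneg (pow_nonneg ht.1 _) (hFnn _).1
  have hle : ∀ r ∈ Icc 0 R, u r ≤ a := by
    refine fun r hr => image_le_of_deriv_right_lt_deriv_boundary (a := 0) (b := R)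
      (B := fun _ => a) (B' := fun _ => 0)
      huc.continuousOn (fun x _ => (hder x).hasDerivWithinAt) (by simp [hu0, ha0.le])
      (fun x => hasDerivAt_const x a) ?_ hr
    intro x hx hxa
    have hx0 : 0 < x := by
      rcases hx.1.eq_or_lt with h | h
      · rw [← h, hu0] at hxa
        exact absurd hxa ha0.ne
      · exact h
    have hav : avgOp n (fun s => F (u s)) x = a / x := by
      have := hu x
      rw [hxa] at this
      field_simp
      linarith
    have hFa : F (u x) = fP K β a := by
      rw [hxa]
      simp [F, projIcc]
      rw [max_eq_right ha0.le]
    rw [hav, hFa]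
    have h4 : (n:ℝ) * a / R ≤ n * a / x := by
      have := hx.2.le
      gcongr
    have h5 : (n:ℝ) * (a / x) = n * a / x := by ring
    linarith
  have hFeq : ∀ r ∈ Icc 0 R, F (u r) = fP K β (u r) := by
    intro r hr
    have : u r ∈ Icc 0 a := ⟨hnn r hr.1, hle r hr⟩
    simp only [F]
    rw [projIcc_of_mem _ this]
  have habs : ∀ r ∈ Icc 0 R, |u r| < 1 := by
    intro r hr
    rw [abs_of_nonneg (hnn r hr.1)]
    linarith [hle r hr]
  refine ⟨u, huc, ⟨huc.continuousOn, hu0, fun r hr => ⟨habs r (Ioo_subset_Icc_self hr), ?_⟩⟩,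
    habs, ?_⟩
  · refine (hder r).congr_deriv ?_
    rw [hFeq r (Ioo_subset_Icc_self hr)]
    have hr0 : r ≠ 0 := hr.1.ne'
    have := hu r
    have hav : avgOp n (fun s => F (u s)) r = u r / r := by
      field_simp
      linarith
    rw [hav]
    ring
  · intro r hr
    conv_lhs => rw [hu r]
    congr 1
    unfold avgOp
    apply intervalIntegral.integral_congr
    intro t ht
    rw [uIcc_of_le zero_le_one] at ht
    simp only
    rw [hFeq]
    exact ⟨mul_nonneg hr.1 ht.1, (mul_le_of_le_one_right hr.1 ht.2).trans hr.2⟩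

theorem exists_global (n : ℕ) (hn : 1 ≤ n) {K β : ℝ} (hK : 0 < K) (hβ : 0 < β) :
    ∃ u : ℝ → ℝ, Continuous u ∧ (∀ r, |u r| < 1) ∧
      ∀ r, u r = r * avgOp n (fun s => fP K β (u s)) r := by
  choose! w hwc hwU hw1 hwe using exists_local n hn hK hβ
  let U : ℝ → ℝ := fun r => w (r + 1) r
  have hUw : ∀ r, 0 ≤ r → ∀ R, r < R → U r = w R r := by
    intro r hr R hrR
    have h1 := (hwU (r + 1) (by linarith)).mono (min_le_left (r + 1) R)
    have h2 := (hwU R (by linarith)).mono (min_le_right (r + 1) R)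
    exact h1.unique hn hK hβ h2 ⟨hr, lt_min (by linarith) hrR⟩
  let g : ℝ → ℝ := fun r => fP K β (U |r|)
  have hgc : Continuous g := by
    rw [continuous_iff_continuousAt]
    intro r0
    have hev : g =ᶠ[𝓝 r0] fun r => fP K β (w (|r0| + 1) |r|) := by
      have : ∀ᶠ r in 𝓝 r0, |r| < |r0| + 1 :=
        continuous_abs.continuousAt.eventually (gt_mem_nhds (by linarith))
      filter_upwards [this] with r hr
      simp only [g]
      rw [hUw |r| (abs_nonneg r) _ hr]
    refine ContinuousAt.congr ?_ hev.symm
    have h1 := fP_cont K hβ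
    have h2 := hwc (|r0| + 1) (by positivity)
    exact Continuous.continuousAt (by fun_prop)
  have hUe : ∀ r, 0 ≤ r → U r = r * avgOp n g r := by
    intro r hr
    have h1 := hwe (r + 1) (by linarith) r ⟨hr, by linarith⟩
    simp only [U]
    rw [h1]
    congr 1
    unfold avgOp
    apply intervalIntegral.integral_congr
    intro t ht
    rw [uIcc_of_le zero_le_one] at ht
    simp only [g]
    have h2 : 0 ≤ r * t := mul_nonneg hr ht.1
    have h3 : r * t ≤ r := mul_le_of_le_one_right hr ht.2
    rw [abs_of_nonneg h2, hUw _ h2 (r + 1) (by linarith)]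
  have hU1 : ∀ r, 0 ≤ r → |U r| < 1 := fun r hr =>
    hw1 (r + 1) (by linarith) r ⟨hr, by linarith⟩
  have hodd : ∀ r, (-r) * avgOp n g (-r) = -(r * avgOp n g r) := by
    intro r
    have : avgOp n g (-r) = avgOp n g r := by
      unfold avgOp
      apply intervalIntegral.integral_congr
      intro t _
      simp only [g]
      rw [neg_mul, abs_neg]
    rw [this]
    ring
  have hcase : ∀ r, r * avgOp n g r = U |r| ∨ r * avgOp n g r = - U |r| := by
    intro r
    rcases le_total 0 r with h | h
    · left
      rw [abs_of_nonneg h, hUe r h]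
    · right
      rw [abs_of_nonpos h, hUe (-r) (by linarith), hodd]
      ring
  have hfg : ∀ r, fP K β (r * avgOp n g r) = g r := by
    intro r
    rcases hcase r with h | h
    · rw [h]
    · rw [h, fP_neg]
  refine ⟨fun r => r * avgOp n g r, ?_, ?_, ?_⟩
  · have := avgOp_continuous n hgc
    fun_prop
  · intro r
    have h0 := hU1 |r| (abs_nonneg r)
    rcases hcase r with h | h
    · simp only [h]
      exact h0
    · simp only [h, abs_neg]
      exact h0
  · intro r
    simp only [hfg]

/-- a global solution of the integral equation -/
def IsG (n : ℕ) (K β : ℝ) (u : ℝ → ℝ) : Prop :=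
  Continuous u ∧ (∀ r, |u r| < 1) ∧ ∀ r, u r = r * avgOp n (fun s => fP K β (u s)) r

/-- the derivative of a global solution -/
noncomputable def dU (n : ℕ) (K β : ℝ) (u : ℝ → ℝ) (r : ℝ) : ℝ :=
  fP K β (u r) - n * avgOp n (fun s => fP K β (u s)) r

theorem IsG.zero {n : ℕ} {K β : ℝ} {u : ℝ → ℝ} (h : IsG n K β u) : u 0 = 0 := by
  rw [h.2.2 0]; simp

theorem IsG.gcont {n : ℕ} {K β : ℝ} (hβ : 0 < β) {u : ℝ → ℝ} (h : IsG n K β u) :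
    Continuous (fun s => fP K β (u s)) := (fP_cont K hβ).comp h.1

theorem IsG.hasDerivAt {n : ℕ} {K β : ℝ} (hβ : 0 < β) {u : ℝ → ℝ} (h : IsG n K β u) (r : ℝ) :
    HasDerivAt u (dU n K β u r) r :=
  (mul_avgOp_hasDerivAt n (h.gcont hβ) r).congr_of_eventuallyEq
    (Filter.Eventually.of_forall h.2.2)

theorem IsG.dU_eq {n : ℕ} {K β : ℝ} {u : ℝ → ℝ} (h : IsG n K β u) {r : ℝ} (hr : r ≠ 0) :
    dU n K β u r = fP K β (u r) - n * u r / r := by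
  unfold dU
  have := h.2.2 r
  have hav : avgOp n (fun s => fP K β (u s)) r = u r / r := by
    field_simp
    linarith
  rw [hav]
  ring

theorem IsG.isU {n : ℕ} {K β : ℝ} (hβ : 0 < β) {u : ℝ → ℝ} (h : IsG n K β u) (S : ℝ) :
    IsU n K β S u :=
  ⟨h.1.continuousOn, h.zero, fun r hr => ⟨h.2.1 r, by
    rw [← h.dU_eq hr.1.ne']
    exact h.hasDerivAt hβ r⟩⟩

theorem IsG.contDiff_nat {n : ℕ} {K β : ℝ} (hβ : 0 < β) {u : ℝ → ℝ} (h : IsG n K β u) (k : ℕ) :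
    ContDiff ℝ k u := by
  induction k with
  | zero => exact contDiff_zero.2 h.1
  | succ k ih =>
    push_cast
    rw [contDiff_succ_iff_deriv]
    refine ⟨fun r => (h.hasDerivAt hβ r).differentiableAt, by simp, ?_⟩
    have hd : deriv u = dU n K β u := funext fun r => (h.hasDerivAt hβ r).deriv
    rw [hd]
    have hg : ContDiff ℝ k (fun s => fP K β (u s)) := by
      rw [contDiff_iff_contDiffAt]
      intro r
      exact (fP_contDiffAt K β (h.2.1 r)).comp r ih.contDiffAt
    exact hg.sub (contDiff_const.mul (avgOp_contDiff k n hg))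

theorem IsG.contDiff {n : ℕ} {K β : ℝ} (hβ : 0 < β) {u : ℝ → ℝ} (h : IsG n K β u) :
    ContDiff ℝ (⊤ : ℕ∞) u := contDiff_infty.2 (h.contDiff_nat hβ)

theorem IsG.dU_cont {n : ℕ} {K β : ℝ} (hβ : 0 < β) {u : ℝ → ℝ} (h : IsG n K β u) :
    Continuous (dU n K β u) := by
  unfold dU
  exact (h.gcont hβ).sub (continuous_const.mul (avgOp_continuous n (h.gcont hβ)))

theorem IsG.pos {n : ℕ} {K β : ℝ} (hK : 0 < K) (hβ : 0 < β) {u : ℝ → ℝ}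
    (h : IsG n K β u) {r : ℝ} (hr : 0 < r) : 0 < u r := by
  rw [h.2.2 r]
  apply mul_pos hr
  unfold avgOp
  have hc := h.gcont hβ
  apply intervalIntegral.intervalIntegral_pos_of_pos_on
  · exact Continuous.intervalIntegrable
      ((continuous_pow n).mul (hc.comp (continuous_const.mul continuous_id))) _ _
  · intro t ht
    exact mul_pos (pow_pos ht.1 _) (fP_pos hK (h.2.1 _))
  · exact one_pos

theorem IsG.dU_zero_pos {n : ℕ} {K β : ℝ} (hK : 0 < K) {u : ℝ → ℝ}
    (h : IsG n K β u) : 0 < dU n K β u 0 := by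
  unfold dU
  rw [avgOp_zero]
  have h1 := fP_pos (β := β) hK (h.2.1 0)
  have h2 : (0:ℝ) < n + 1 := by positivity
  have h3 : fP K β (u 0) - n * (fP K β (u 0) / (n + 1)) = fP K β (u 0) / (n + 1) := by
    field_simp
    ring
  rw [h3]
  positivity

theorem IsG.dU_pos {n : ℕ} (hn : 1 ≤ n) {K β : ℝ} (hK : 0 < K) (hβ : 0 < β) {u : ℝ → ℝ}
    (h : IsG n K β u) {r : ℝ} (hr : 0 ≤ r) : 0 < dU n K β u r := by
  by_contra! hneg
  have hdc := h.dU_cont hβ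
  let T : Set ℝ := Icc 0 r ∩ {s | dU n K β u s ≤ 0}
  have hTc : IsCompact T := isCompact_Icc.inter_right (isClosed_le hdc continuous_const)
  obtain ⟨r0, hr0⟩ := hTc.exists_isLeast ⟨r, ⟨hr, le_rfl⟩, hneg⟩
  have hr0T : r0 ∈ T := hr0.1
  have hbefore : ∀ s, 0 ≤ s → s < r0 → 0 < dU n K β u s := by
    intro s hs hsr
    by_contra! hs'
    exact absurd (hr0.2 ⟨⟨hs, hsr.le.trans hr0T.1.2⟩, hs'⟩) (not_le.2 hsr)
  have hr0pos : 0 < r0 := by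
    rcases hr0T.1.1.eq_or_lt with h1 | h1
    · have h2 := hr0T.2
      rw [← h1] at h2
      exact absurd (h.dU_zero_pos hK) (not_lt.2 h2)
    · exact h1
  have hz : dU n K β u r0 = 0 := by
    apply le_antisymm hr0T.2
    have ht : Tendsto (dU n K β u) (𝓝[<] r0) (𝓝 (dU n K β u r0)) :=
      (hdc.tendsto r0).mono_left nhdsWithin_le_nhds
    refine ge_of_tendsto ht ?_
    filter_upwards [Ioo_mem_nhdsLT hr0pos] with s hs
    exact (hbefore s hs.1.le hs.2).le
  -- derivative of dU at r0
  have hu' : HasDerivAt u 0 r0 := by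
    have := h.hasDerivAt hβ r0
    rwa [hz] at this
  have hf' : HasDerivAt (fun s => fP K β (u s)) 0 r0 := by
    have h1 := ((fP_contDiffAt K β (h.2.1 r0) (m := 1)).differentiableAt one_ne_zero).hasDerivAt
    have h2 := h1.comp r0 hu'
    rw [mul_zero] at h2
    exact h2
  have hd : HasDerivAt (dU n K β u) (n * u r0 / r0 ^ 2) r0 := by
    have h1 := hf'.sub ((hu'.const_mul (n:ℝ)).div (hasDerivAt_id r0) hr0pos.ne')
    have h2 : dU n K β u =ᶠ[𝓝 r0] fun s => fP K β (u s) - n * u s / s := by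
      filter_upwards [lt_mem_nhds hr0pos] with s hs
      exact h.dU_eq hs.ne'
    refine (h1.congr_of_eventuallyEq h2).congr_deriv ?_
    simp
    ring
  have hup := h.pos hK hβ hr0pos
  have hn' : (0:ℝ) < n := by exact_mod_cast hn
  have hpos : 0 < n * u r0 / r0 ^ 2 := by positivity
  have hsl := (hasDerivAt_iff_tendsto_slope.1 hd).mono_left (nhdsLT_le_nhdsNE r0)
  have hev := hsl.eventually (lt_mem_nhds hpos)
  obtain ⟨s, hs1, hs2⟩ := (hev.and (Ioo_mem_nhdsLT hr0pos)).exists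
  have h3 := hbefore s hs2.1.le hs2.2
  rw [slope_def_field, hz] at hs1
  have h4 : s - r0 < 0 := by linarith [hs2.2]
  have h5 := div_neg_of_pos_of_neg (by linarith : 0 < dU n K β u s - 0) h4
  linarith

theorem IsG.strictMono {n : ℕ} (hn : 1 ≤ n) {K β : ℝ} (hK : 0 < K) (hβ : 0 < β) {u : ℝ → ℝ}
    (h : IsG n K β u) : StrictMonoOn u (Ici 0) := by
  apply strictMonoOn_of_deriv_pos (convex_Ici 0) h.1.continuousOn
  intro r hr
  rw [interior_Ici] at hr
  rw [(h.hasDerivAt hβ r).deriv]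
  exact h.dU_pos hn hK hβ (le_of_lt hr)

/-- `r f(u(r))` is bounded -/
theorem IsG.rf_le {n : ℕ} (hn : 1 ≤ n) {K β : ℝ} (hK : 0 < K) (hβ : 0 < β) {u : ℝ → ℝ}
    (h : IsG n K β u) {r : ℝ} (hr : 0 < r) : r * fP K β (u r) ≤ n + 1 := by
  have hc := h.gcont hβ
  have h1 : fP K β (u r) / (n + 1) ≤ avgOp n (fun s => fP K β (u s)) r := by
    have h2 : ∫ t in (0:ℝ)..1, t ^ n * fP K β (u r) = fP K β (u r) / (n + 1) := by
      rw [intervalIntegral.integral_mul_const, integral_pow]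
      simp
      ring
    rw [← h2]
    unfold avgOp
    apply intervalIntegral.integral_mono_on zero_le_one
    · exact Continuous.intervalIntegrable (by fun_prop) _ _
    · exact Continuous.intervalIntegrable
        ((continuous_pow n).mul (hc.comp (continuous_const.mul continuous_id))) _ _
    · intro t ht
      apply mul_le_mul_of_nonneg_left _ (pow_nonneg ht.1 _)
      have h3 : 0 ≤ r * t := mul_nonneg hr.le ht.1
      have h4 : r * t ≤ r := mul_le_of_le_one_right hr.le ht.2
      have h5 : 0 ≤ u (r * t) := by
        have := (h.strictMono hn hK hβ).monotoneOn (by simp : (0:ℝ) ∈ Ici 0) h3 h3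
        rwa [h.zero] at this
      exact fP_anti hK hβ h5 ((h.strictMono hn hK hβ).monotoneOn h3 hr.le h4)
        (abs_lt.1 (h.2.1 r)).2.le
  have h6 := h.2.2 r
  have h7 := (abs_lt.1 (h.2.1 r)).2
  have h8 : (0:ℝ) < n + 1 := by positivity
  rw [div_le_iff₀ h8] at h1
  nlinarith

theorem IsG.tendsto_one {n : ℕ} (hn : 1 ≤ n) {K β : ℝ} (hK : 0 < K) (hβ : 0 < β) {u : ℝ → ℝ}
    (h : IsG n K β u) : Tendsto u atTop (𝓝 1) := by
  have hmono := (h.strictMono hn hK hβ).monotoneOn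
  rw [tendsto_order]
  constructor
  · intro a ha
    by_contra hcon
    have hle : ∀ r, 0 < r → u r ≤ a := by
      intro r hr
      by_contra! hlt
      apply hcon
      filter_upwards [eventually_ge_atTop r] with s hs
      exact hlt.trans_le (hmono hr.le (hr.le.trans hs) hs)
    have ha0 : 0 < a := (h.pos hK hβ one_pos).trans_le (hle 1 one_pos)
    have hfa : 0 < fP K β a := fP_pos hK (by rwa [abs_of_pos ha0])
    obtain ⟨r, hr⟩ := exists_gt (max 1 ((n + 1) / fP K β a))
    have hr0 : 0 < r := one_pos.trans_le ((le_max_left _ _).trans hr.le)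
    have h1 := h.rf_le hn hK hβ hr0
    have h2 := fP_anti hK hβ (h.pos hK hβ hr0).le (hle r hr0) ha.le
    have h3 : (n + 1) / fP K β a < r := (le_max_right _ _).trans_lt hr
    rw [div_lt_iff₀ hfa] at h3
    nlinarith
  · intro a ha
    exact Filter.Eventually.of_forall fun r => ((abs_lt.1 (h.2.1 r)).2).trans ha

/-- the defect `r u'(r)` tends to zero -/
theorem IsG.tendsto_defect {n : ℕ} (hn : 1 ≤ n) {K β : ℝ} (hK : 0 < K) (hβ : 0 < β) {u : ℝ → ℝ}
    (h : IsG n K β u) : Tendsto (fun r => r * dU n K β u r) atTop (𝓝 0) := by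
  have hmono := (h.strictMono hn hK hβ).monotoneOn
  have h1 := h.tendsto_one hn hK hβ
  have hn1 : (0:ℝ) < n + 1 := by positivity
  -- the main inequality
  have key : ∀ e : ℝ, 0 < e → e ≤ 1 / 2 → ∀ r, 0 < r →
      r * dU n K β u r ≤ (u r - u ((1 - e) * r)) / e + 2 * (n + 1) * e := by
    intro e he he2 r hr
    have hlt : (1 - e) * r < r := by nlinarith
    have hpos : 0 < (1 - e) * r := by nlinarith
    obtain ⟨x, hx, hxe⟩ := exists_hasDerivAt_eq_slope u (dU n K β u) hlt h.1.continuousOn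
      (fun x _ => h.hasDerivAt hβ x)
    have hx0 : 0 < x := hpos.trans hx.1
    have hdx := h.dU_pos hn hK hβ hx0.le
    have hq1 := h.dU_eq hr.ne'
    have hq2 := h.dU_eq hx0.ne'
    have hux : u x ≤ u r := hmono hx0.le hr.le hx.2.le
    have hfx : fP K β (u r) ≤ fP K β (u x) :=
      fP_anti hK hβ (h.pos hK hβ hx0).le hux (abs_lt.1 (h.2.1 r)).2.le
    have hq1' : r * dU n K β u r = r * fP K β (u r) - n * u r := by
      rw [hq1]; field_simp
    have hq2' : x * dU n K β u x = x * fP K β (u x) - n * u x := by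
      rw [hq2]; field_simp
    have hb := h.rf_le hn hK hβ hx0
    have hfpos := fP_pos (β := β) hK (h.2.1 x)
    have hn0 : (0:ℝ) ≤ n := by positivity
    have hslope : r * dU n K β u x = (u r - u ((1 - e) * r)) / e := by
      rw [hxe]
      have : r - (1 - e) * r = e * r := by ring
      rw [this]
      field_simp
    rw [← hslope]
    have hxr : x * dU n K β u x ≤ r * dU n K β u x := by
      have := hx.2.le
      gcongr
    have hstep : (r - x) * fP K β (u x) ≤ 2 * (n + 1) * e := by
      have h3 : r - x ≤ e * r := by linarith [hx.1]
      have h4 : r ≤ 2 * x := by nlinarith [hx.1]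
      have h5 : r - x ≤ 2 * e * x := by nlinarith
      nlinarith
    nlinarith [mul_le_mul_of_nonneg_left hfx hr.le, mul_le_mul_of_nonneg_left hux hn0]
  rw [tendsto_order]
  constructor
  · intro a ha
    filter_upwards [eventually_gt_atTop 0] with r hr
    exact ha.trans (mul_pos hr (h.dU_pos hn hK hβ hr.le))
  · intro a ha
    obtain ⟨e, he, he2, hea⟩ : ∃ e : ℝ, 0 < e ∧ e ≤ 1 / 2 ∧ 2 * (n + 1) * e < a := by
      refine ⟨min (1 / 2) (a / (4 * (n + 1))), by positivity, min_le_left _ _, ?_⟩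
      calc 2 * ((n:ℝ) + 1) * min (1 / 2) (a / (4 * (n + 1)))
          ≤ 2 * (n + 1) * (a / (4 * (n + 1))) := by
            gcongr
            exact min_le_right _ _
        _ = a / 2 := by field_simp; ring
        _ < a := by linarith
    have ht : Tendsto (fun r => (u r - u ((1 - e) * r)) / e + 2 * (n + 1) * e) atTop
        (𝓝 ((1 - 1) / e + 2 * (n + 1) * e)) := by
      have h2 : Tendsto (fun r : ℝ => (1 - e) * r) atTop atTop :=
        tendsto_id.const_mul_atTop (by linarith)
      exact ((h1.sub (h1.comp h2)).div_const e).add_const _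
    have hlim : (1 - 1) / e + 2 * (n + 1) * e < a := by simpa using hea
    filter_upwards [ht.eventually (gt_mem_nhds hlim), eventually_gt_atTop 0] with r hr hr0
    exact (key e he he2 r hr0).trans_lt hr

/-- slope from the sine of the angle -/
noncomputable def vOf (u : ℝ → ℝ) (r : ℝ) : ℝ := u r / Real.sqrt (1 - u r ^ 2)

theorem upper_growth {φ v : ℝ → ℝ} (hφ : ∀ r, HasDerivAt φ (v r) r) {α B b : ℝ} (hα : 0 < α)
    (hB : ∀ᶠ r in atTop, v r ≤ B * r ^ α) (hb : B / (α + 1) < b) :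
    ∀ᶠ r in atTop, φ r / r ^ (α + 1) < b := by
  have hα1 : 0 < α + 1 := by linarith
  obtain ⟨r0, hr0⟩ := eventually_atTop.1 hB
  set r1 := max r0 1
  have hr1 : 0 < r1 := one_pos.trans_le (le_max_right _ _)
  have hder : ∀ r, 0 < r → HasDerivAt (fun r => φ r - B / (α + 1) * r ^ (α + 1))
      (v r - B * r ^ α) r := by
    intro r hr
    have h1 := (hφ r).sub
      ((Real.hasDerivAt_rpow_const (p := α + 1) (Or.inl hr.ne')).const_mul (B / (α + 1)))
    refine h1.congr_deriv ?_
    rw [add_sub_cancel_right]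
    field_simp
  have hanti : AntitoneOn (fun r => φ r - B / (α + 1) * r ^ (α + 1)) (Ici r1) := by
    apply antitoneOn_of_deriv_nonpos (convex_Ici r1)
    · intro r hr
      exact (hder r (hr1.trans_le hr)).continuousAt.continuousWithinAt
    · intro r hr
      rw [interior_Ici] at hr
      exact (hder r (hr1.trans hr)).differentiableAt.differentiableWithinAt
    · intro r hr
      rw [interior_Ici] at hr
      rw [(hder r (hr1.trans hr)).deriv]
      linarith [hr0 r ((le_max_left _ _).trans (le_of_lt hr))]
  set C := φ r1 - B / (α + 1) * r1 ^ (α + 1)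
  have ht : Tendsto (fun r : ℝ => C / r ^ (α + 1) + B / (α + 1)) atTop
      (𝓝 (0 + B / (α + 1))) :=
    ((tendsto_rpow_atTop hα1).const_div_atTop C).add_const _
  rw [zero_add] at ht
  filter_upwards [ht.eventually (gt_mem_nhds hb), eventually_ge_atTop r1] with r h1 h2
  have hr : 0 < r := hr1.trans_le h2
  have hrp : 0 < r ^ (α + 1) := Real.rpow_pos_of_pos hr _
  refine lt_of_le_of_lt ?_ h1
  have h3 : φ r - B / (α + 1) * r ^ (α + 1) ≤ C := hanti (by simp : r1 ∈ Ici r1) h2 h2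
  have h4 : C / r ^ (α + 1) + B / (α + 1) = (C + B / (α + 1) * r ^ (α + 1)) / r ^ (α + 1) := by
    field_simp
  rw [h4]
  gcongr
  linarith

theorem growth {φ v : ℝ → ℝ} (hφ : ∀ r, HasDerivAt φ (v r) r) {α A : ℝ} (hα : 0 < α)
    (hv : Tendsto (fun r => v r / r ^ α) atTop (𝓝 A)) :
    Tendsto (fun r => φ r / r ^ (α + 1)) atTop (𝓝 (A / (α + 1))) := by
  have hα1 : 0 < α + 1 := by linarith
  rw [tendsto_order]
  constructor
  · intro a ha
    obtain ⟨a', ha1, ha2⟩ := exists_between ha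
    have hlt : a' * (α + 1) < A := by
      rwa [lt_div_iff₀ hα1] at ha2
    have h := upper_growth (φ := fun r => -φ r) (v := fun r => -v r) (fun r => (hφ r).neg)
      (B := -(a' * (α + 1))) (b := -a) hα ?_ ?_
    · filter_upwards [h] with r hr
      rw [neg_div] at hr
      linarith
    · filter_upwards [hv.eventually (lt_mem_nhds hlt), eventually_gt_atTop 0] with r h1 h2
      rw [lt_div_iff₀ (Real.rpow_pos_of_pos h2 _)] at h1
      linarith
    · rw [neg_div, mul_div_cancel_right₀ _ hα1.ne']
      linarith
  · intro a ha
    obtain ⟨a', ha1, ha2⟩ := exists_between ha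
    have hlt : A < a' * (α + 1) := by
      rwa [div_lt_iff₀ hα1] at ha1
    refine upper_growth hφ (B := a' * (α + 1)) hα ?_ ?_
    · filter_upwards [hv.eventually (gt_mem_nhds hlt), eventually_gt_atTop 0] with r h1 h2
      rw [div_lt_iff₀ (Real.rpow_pos_of_pos h2 _)] at h1
      exact h1.le
    · rw [mul_div_cancel_right₀ _ hα1.ne']
      exact ha2

theorem IsG.v_growth {n : ℕ} (hn : 1 ≤ n) {α c : ℝ} (hα : 0 < α) (hc : 0 < c) {u : ℝ → ℝ}
    (h : IsG n (c ^ (1 / α)) (1 / (2 * α)) u) :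
    Tendsto (fun r => vOf u r / r ^ α) atTop (𝓝 (c / (n:ℝ) ^ α)) := by
  set K := c ^ (1 / α) with hKdef
  have hK : 0 < K := Real.rpow_pos_of_pos hc _
  have hβ : 0 < 1 / (2 * α) := by positivity
  set β := 1 / (2 * α) with hβdef
  have hn0 : (0:ℝ) < n := by exact_mod_cast hn
  have h1 := h.tendsto_one hn hK hβ
  have h2 := h.tendsto_defect hn hK hβ
  have h3 : Tendsto (fun r => (r * dU n K β u r + n * u r) / K) atTop (𝓝 ((0 + n * 1) / K)) :=
    (h2.add (h1.const_mul _)).div_const K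
  have h4 : Tendsto (fun r => ((r * dU n K β u r + n * u r) / K) ^ α) atTop
      (𝓝 (((0 + n * 1) / K) ^ α)) :=
    h3.rpow_const (Or.inr hα.le)
  have hKα : K ^ α = c := by
    rw [hKdef, ← Real.rpow_mul hc.le]
    rw [one_div_mul_cancel hα.ne', Real.rpow_one]
  have hlim : ((0 + n * 1) / K) ^ α = (n:ℝ) ^ α / c := by
    rw [zero_add, mul_one, Real.div_rpow hn0.le hK.le, hKα]
  rw [hlim] at h4
  have hne : (n:ℝ) ^ α / c ≠ 0 := by
    have := Real.rpow_pos_of_pos hn0 α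
    positivity
  have h5 := h1.div h4 hne
  have h6 : (1:ℝ) / ((n:ℝ) ^ α / c) = c / (n:ℝ) ^ α := by
    rw [one_div_div]
  rw [h6] at h5
  refine h5.congr' ?_
  filter_upwards [eventually_gt_atTop 0] with r hr
  have hs := one_sub_sq_pos (h.2.1 r)
  have h7 : (r * dU n K β u r + n * u r) / K = r * (1 - u r ^ 2) ^ β := by
    rw [h.dU_eq hr.ne']
    unfold fP
    field_simp
    ring
  have h8 : (r * (1 - u r ^ 2) ^ β) ^ α = r ^ α * Real.sqrt (1 - u r ^ 2) := by
    rw [Real.mul_rpow hr.le (Real.rpow_pos_of_pos hs _).le, ← Real.rpow_mul hs.le,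
      Real.sqrt_eq_rpow]
    congr 2
    rw [hβdef]
    field_simp
  simp only [Pi.div_apply]
  rw [h7, h8]
  unfold vOf
  have := Real.sqrt_pos.2 hs
  have := Real.rpow_pos_of_pos hr α
  field_simp

theorem oddPow_eq {α c u q : ℝ} (hα : 0 < α) (hc : 0 < c) (hq : 0 < q)
    (hqu : q ^ 2 * (1 - u ^ 2) = 1) :
    oddPow (c / q - 0) (1 / α) = fP (c ^ (1 / α)) (1 / (2 * α)) u := by
  have h1 : 1 - u ^ 2 = (1 / q) ^ (2:ℝ) := by
    rw [Real.rpow_two]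
    field_simp
    linarith
  have h2 : 0 ≤ c / q := by positivity
  unfold oddPow fP
  rw [sub_zero, if_pos h2, h1, ← Real.rpow_mul (by positivity), div_eq_mul_one_div c q,
    Real.mul_rpow hc.le (by positivity)]
  congr 2
  field_simp

theorem IsG.v_hasDerivAt {n : ℕ} {K β : ℝ} (hβ : 0 < β) {u : ℝ → ℝ} (h : IsG n K β u) (r : ℝ) :
    HasDerivAt (vOf u) (dU n K β u r / Real.sqrt (1 - u r ^ 2) ^ 3) r := by
  have hs := one_sub_sq_pos (h.2.1 r)
  have hq := Real.sqrt_pos.2 hs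
  have h1 := h.hasDerivAt hβ r
  have h2 := ((h1.pow 2).const_sub 1).sqrt hs.ne'
  have h3 := h1.div h2 hq.ne'
  refine h3.congr_deriv ?_
  have h4 := Real.sq_sqrt hs.le
  simp only [Pi.pow_apply]
  set q := Real.sqrt (1 - u r ^ 2)
  field_simp
  norm_num
  rw [h4]
  left
  ring

theorem IsG.v_contDiff {n : ℕ} {K β : ℝ} (hβ : 0 < β) {u : ℝ → ℝ} (h : IsG n K β u) :
    ContDiff ℝ (⊤ : ℕ∞) (vOf u) := by
  have hu := h.contDiff hβ
  unfold vOf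
  refine hu.div ((contDiff_const.sub (hu.pow 2)).sqrt fun r => ?_) fun r => ?_
  · exact (one_sub_sq_pos (h.2.1 r)).ne'
  · exact (Real.sqrt_pos.2 (one_sub_sq_pos (h.2.1 r))).ne'

/-- any solution of the profile problem yields a solution of the first-order problem -/
theorem profile_isU {n : ℕ} {α c S : ℝ} (hα : 0 < α) (hc : 0 < c) {ψ ψ' ψ'' : ℝ → ℝ}
    (h : IsProfileSolOn (n + 1) α 0 c (Ico 0 S) ψ ψ' ψ'') :
    IsU n (c ^ (1 / α)) (1 / (2 * α)) S (fun r => ψ' r / Real.sqrt (1 + ψ' r ^ 2)) := by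
  obtain ⟨-, h0', -, hd2, heq⟩ := h
  refine ⟨?_, by simp [h0'], fun r hr => ?_⟩
  · have hcont : ContinuousOn ψ' (Ico 0 S) := fun r hr => (hd2 r hr).continuousWithinAt
    refine hcont.div ((continuousOn_const.add (hcont.pow 2)).sqrt) fun r _ => ?_
    positivity
  · have hp : 0 < 1 + ψ' r ^ 2 := by positivity
    have hq := Real.sqrt_pos.2 hp
    have hq2 := Real.sq_sqrt hp.le
    have h1 : HasDerivAt ψ' (ψ'' r) r :=
      (hd2 r (Ioo_subset_Ico_self hr)).hasDerivAt (Ico_mem_nhds hr.1 hr.2)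
    have h2 := ((h1.pow 2).const_add 1).sqrt hp.ne'
    have h3 := h1.div h2 hq.ne'
    have h4 := heq r (Ioo_subset_Ico_self hr) hr.1.ne'
    have hr0 : r ≠ 0 := hr.1.ne'
    constructor
    · rw [abs_div, abs_of_pos hq, div_lt_one hq]
      apply Real.lt_sqrt_of_sq_lt
      rw [sq_abs]
      linarith
    · refine h3.congr_deriv ?_
      have h5 := oddPow_eq (u := ψ' r / Real.sqrt (1 + ψ' r ^ 2)) hα hc hq (by
        field_simp
        rw [hq2]
        ring)
      simp only [Pi.pow_apply]
      rw [h5] at h4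
      rw [← hq2] at h4
      simp only [Real.sqrt_sq hq.le] at h4
      set q := Real.sqrt (1 + ψ' r ^ 2)
      set f := fP (c ^ (1 / α)) (1 / (2 * α)) (ψ' r / q)
      push_cast at h4
      rw [add_sub_cancel_right] at h4
      have h6 : f = (ψ'' r / q ^ 2 + n / r * ψ' r) / q := by
        rw [h4]
        field_simp
      rw [h6]
      have h7 : ψ' r ^ 2 = q ^ 2 - 1 := by linarith
      field_simp
      norm_num
      linear_combination (-(2 * ψ'' r * r)) * h7

/-- for `b = 0`, the translating-profile problem has a unique solution,
defined and `C^∞` on all of `[0, ∞)`, with `Φ' > 0`, `Φ'' > 0` on `(0, ∞)` and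
`Φ(r)/r^{α+1} → c/((α+1)(N−1)^α)` as `r → ∞`. -/
theorem stmt0 (N : ℕ) (hN : 1 < N) (α : ℝ) (hα : 0 < α) (c : ℝ) (hc : 0 < c) :
    ∃ φ φ' φ'' : ℝ → ℝ,
      IsProfileSolOn N α 0 c (Set.Ici 0) φ φ' φ'' ∧
      (∀ (S : ℝ) (ψ ψ' ψ'' : ℝ → ℝ), 0 < S →
        IsProfileSolOn N α 0 c (Set.Ico 0 S) ψ ψ' ψ'' → Set.EqOn ψ φ (Set.Ico 0 S)) ∧
      ContDiffOn ℝ (⊤ : ℕ∞) φ (Set.Ici 0) ∧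
      (∀ r : ℝ, 0 < r → 0 < φ' r ∧ 0 < φ'' r) ∧
      Filter.Tendsto (fun r : ℝ => φ r / r ^ (α + 1)) Filter.atTop
        (nhds (c / ((α + 1) * ((N : ℝ) - 1) ^ α))) := by
  obtain ⟨n, rfl⟩ : ∃ n, N = n + 1 := ⟨N - 1, by omega⟩
  have hn : 1 ≤ n := by omega
  have hK : 0 < c ^ (1 / α) := Real.rpow_pos_of_pos hc _
  have hβ : 0 < 1 / (2 * α) := by positivity
  obtain ⟨u, hu⟩ : ∃ u, IsG n (c ^ (1 / α)) (1 / (2 * α)) u := exists_global n hn hK hβ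
  have hvc : Continuous (vOf u) := (hu.v_contDiff hβ).continuous
  let φ : ℝ → ℝ := fun r => ∫ s in (0:ℝ)..r, vOf u s
  have hφ : ∀ r, HasDerivAt φ (vOf u r) r := fun r =>
    intervalIntegral.integral_hasDerivAt_right (hvc.intervalIntegrable _ _)
      hvc.stronglyMeasurable.stronglyMeasurableAtFilter hvc.continuousAt
  have hφ0 : φ 0 = 0 := by simp [φ]
  have hN : (((n + 1 : ℕ) : ℝ) - 1) = n := by push_cast; ring
  refine ⟨φ, vOf u, fun r => dU n (c ^ (1 / α)) (1 / (2 * α)) u r / Real.sqrt (1 - u r ^ 2) ^ 3,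
    ⟨hφ0, by simp [vOf, hu.zero], fun r _ => (hφ r).hasDerivWithinAt,
      fun r _ => (hu.v_hasDerivAt hβ r).hasDerivWithinAt, ?_⟩, ?_, ?_, ?_, ?_⟩
  · intro r _ hr0
    have hs := one_sub_sq_pos (hu.2.1 r)
    have hq := Real.sqrt_pos.2 hs
    have hq2 := Real.sq_sqrt hs.le
    have h1 : 1 + vOf u r ^ 2 = (1 / Real.sqrt (1 - u r ^ 2)) ^ 2 := by
      unfold vOf
      field_simp
      rw [hq2]
      ring
    have h2 : Real.sqrt (1 + vOf u r ^ 2) = 1 / Real.sqrt (1 - u r ^ 2) := by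
      rw [h1, Real.sqrt_sq (by positivity)]
    rw [h2, oddPow_eq (u := u r) hα hc (by positivity) (by
      rw [div_pow, one_pow, hq2, one_div_mul_cancel hs.ne']), h1, hN]
    simp only
    rw [hu.dU_eq hr0]
    unfold vOf
    field_simp
    ring
  · intro S ψ ψ' ψ'' hS hψ
    have hU := (profile_isU hα hc hψ).unique hn hK hβ (hu.isU hβ S)
    have hψv : ∀ r ∈ Ico 0 S, ψ' r = vOf u r := by
      intro r hr
      have h1 := hU hr
      simp only at h1
      have hp : 0 < 1 + ψ' r ^ 2 := by positivity
      have hq := Real.sqrt_pos.2 hp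
      have hq2 := Real.sq_sqrt hp.le
      unfold vOf
      rw [← h1]
      have h2 : 1 - (ψ' r / Real.sqrt (1 + ψ' r ^ 2)) ^ 2
          = (1 / Real.sqrt (1 + ψ' r ^ 2)) ^ 2 := by
        field_simp
        rw [hq2]
        ring
      rw [h2, Real.sqrt_sq (by positivity)]
      field_simp
    intro r hr
    have hsub : Icc 0 r ⊆ Ico 0 S := fun x hx => ⟨hx.1, hx.2.trans_lt hr.2⟩
    have hconst := constant_of_has_deriv_right_zero (f := fun x => ψ x - φ x) (a := 0) (b := r)
      (fun x hx => ((hψ.2.2.1 x (hsub hx)).continuousWithinAt.mono hsub).sub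
        (hφ x).continuousAt.continuousWithinAt) (fun x hx => ?_) r ⟨hr.1, le_rfl⟩
    · simp only [hψ.1, hφ0] at hconst
      linarith
    · have hx' : x ∈ Ico 0 S := hsub (Ico_subset_Icc_self hx)
      have h1 : HasDerivWithinAt ψ (ψ' x) (Ici x) x := by
        apply (hψ.2.2.1 x hx').mono_of_mem_nhdsWithin
        filter_upwards [Ico_mem_nhdsGE hx'.2] with y hy
        exact ⟨hx'.1.trans hy.1, hy.2⟩
      have h2 := h1.sub (hφ x).hasDerivWithinAt
      rw [hψv x hx', sub_self] at h2
      exact h2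
  · apply ContDiff.contDiffOn
    rw [contDiff_infty_iff_deriv]
    refine ⟨fun r => (hφ r).differentiableAt, ?_⟩
    have : deriv φ = vOf u := funext fun r => (hφ r).deriv
    rw [this]
    exact hu.v_contDiff hβ
  · intro r hr
    have hq := Real.sqrt_pos.2 (one_sub_sq_pos (hu.2.1 r))
    exact ⟨div_pos (hu.pos hK hβ hr) hq, div_pos (hu.dU_pos hn hK hβ hr.le) (by positivity)⟩
  · have h := growth hφ hα (hu.v_growth hn hα hc)
    rw [hN]
    convert h using 2
    rw [div_div, mul_comm]
end

section
/- Let N > 1 be an integer, α > 0, b = 0 and k > 0. There exists a unique c̃ > 0 such that the translating profile Φ(·; c̃, 0) satisfies the boundary condition Φ'(1; c̃, 0) = k; moreover 0 < c̃ < N^α·√(1+k²). -/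
open Set Filter Topology

/-- Volterra-type fixed point for globally Lipschitz bounded nonlinearities. -/
theorem exists_volterra (d : ℕ) (h : ℝ → ℝ) (K : NNReal) (hh : LipschitzWith K h)
    (hb : ∀ x, |h x| ≤ 1) :
    ∃ u : ℝ → ℝ, Continuous u ∧ ∀ r, u r = r * ∫ t in (0:ℝ)..1, t ^ d * h (u (r * t)) := by
  set l : ℝ := (K : ℝ) + 1 with hl
  have hl1 : 1 ≤ l := by have := K.coe_nonneg; linarith
  have hl0 : 0 < l := by linarith
  have hc := hh.continuous
  have hcont : ∀ w : BoundedContinuousFunction ℝ ℝ, Continuous (fun r : ℝ =>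
      Real.exp (-(l * |r|)) * (r * ∫ t in (0:ℝ)..1, t ^ d * h (Real.exp (l * |r * t|) * w (r * t)))) := by
    intro w
    have hw := w.continuous
    have : Continuous (fun r : ℝ =>
      ∫ t in (0:ℝ)..1, t ^ d * h (Real.exp (l * |r * t|) * w (r * t))) := by
      apply intervalIntegral.continuous_parametric_intervalIntegral_of_continuous'
      simp only [Function.uncurry_def]
      fun_prop
    fun_prop
  have hint : ∀ w : BoundedContinuousFunction ℝ ℝ, ∀ r : ℝ,
      IntervalIntegrable (fun t : ℝ => t ^ d * h (Real.exp (l * |r * t|) * w (r * t)))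
        MeasureTheory.volume 0 1 := by
    intro w r
    have hw := w.continuous
    apply Continuous.intervalIntegrable
    fun_prop
  have hbd : ∀ w : BoundedContinuousFunction ℝ ℝ, ∀ r : ℝ,
      ‖Real.exp (-(l * |r|)) * (r * ∫ t in (0:ℝ)..1, t ^ d * h (Real.exp (l * |r * t|) * w (r * t)))‖ ≤ 1 := by
    intro w r
    have h1 : ‖∫ t in (0:ℝ)..1, t ^ d * h (Real.exp (l * |r * t|) * w (r * t))‖ ≤ 1 * |(1:ℝ) - 0| := by
      apply intervalIntegral.norm_integral_le_of_norm_le_const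
      intro t ht
      rw [uIoc_of_le zero_le_one] at ht
      rw [norm_mul, Real.norm_eq_abs, Real.norm_eq_abs, abs_of_nonneg (pow_nonneg ht.1.le d)]
      exact mul_le_one₀ (pow_le_one₀ ht.1.le ht.2) (abs_nonneg _) (hb _)
    rw [norm_mul, norm_mul, Real.norm_eq_abs (Real.exp _), abs_of_pos (Real.exp_pos _),
      Real.exp_neg, inv_mul_le_iff₀ (Real.exp_pos _), Real.norm_eq_abs r]
    have h2 := Real.add_one_le_exp (l * |r|)
    have h3 : |r| ≤ l * |r| := by nlinarith [abs_nonneg r]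
    calc |r| * _ ≤ |r| * 1 := by
          apply mul_le_mul_of_nonneg_left _ (abs_nonneg r)
          simpa using h1
      _ ≤ _ := by linarith
  let T : BoundedContinuousFunction ℝ ℝ → BoundedContinuousFunction ℝ ℝ := fun w =>
    BoundedContinuousFunction.ofNormedAddCommGroup _ (hcont w) 1 (hbd w)
  have hT : ∀ w r, T w r = Real.exp (-(l * |r|)) * (r * ∫ t in (0:ℝ)..1, t ^ d * h (Real.exp (l * |r * t|) * w (r * t))) := fun w r => rfl
  have hcon : ContractingWith (K / (K + 1)) T := by
    refine ⟨?_, ?_⟩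
    · rw [div_lt_one (by positivity)]; exact lt_add_one K
    · apply LipschitzWith.of_dist_le_mul
      intro w1 w2
      rw [BoundedContinuousFunction.dist_le (by positivity)]
      intro r
      set D := dist w1 w2 with hD
      have hD0 : 0 ≤ D := dist_nonneg
      rw [hT, hT, Real.dist_eq, ← mul_sub, ← mul_sub, ← intervalIntegral.integral_sub (hint w1 r) (hint w2 r),
        abs_mul, abs_mul, abs_of_pos (Real.exp_pos _), Real.exp_neg, inv_mul_le_iff₀ (Real.exp_pos _)]
      have h1 : ‖∫ t in (0:ℝ)..1, (t ^ d * h (Real.exp (l * |r * t|) * w1 (r * t)) - t ^ d * h (Real.exp (l * |r * t|) * w2 (r * t)))‖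
          ≤ ∫ t in (0:ℝ)..1, K * D * Real.exp (l * |r| * t) := by
        apply intervalIntegral.norm_integral_le_of_norm_le zero_le_one
        · refine Filter.Eventually.of_forall fun t ht => ?_
          rw [← mul_sub, norm_mul, Real.norm_eq_abs, abs_of_nonneg (pow_nonneg ht.1.le d)]
          have e1 : ‖h (Real.exp (l * |r * t|) * w1 (r * t)) - h (Real.exp (l * |r * t|) * w2 (r * t))‖
             ≤ K * (Real.exp (l * |r| * t) * D) := by
            refine (hh.norm_sub_le _ _).trans ?_
            apply mul_le_mul_of_nonneg_left _ K.coe_nonneg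
            rw [← mul_sub, norm_mul, Real.norm_eq_abs, abs_of_pos (Real.exp_pos _), abs_mul,
              abs_of_pos ht.1, ← mul_assoc]
            apply mul_le_mul_of_nonneg_left _ (Real.exp_pos _).le
            rw [← dist_eq_norm]
            exact BoundedContinuousFunction.dist_coe_le_dist _
          calc t ^ d * _ ≤ 1 * (K * (Real.exp (l * |r| * t) * D)) := by
                apply mul_le_mul (pow_le_one₀ ht.1.le ht.2) e1 (norm_nonneg _) zero_le_one
            _ = _ := by ring
        · apply Continuous.intervalIntegrable; fun_prop
      have h2 : ∫ t in (0:ℝ)..1, (l * |r|) * Real.exp (l * |r| * t) = Real.exp (l * |r|) - 1 := by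
        rw [intervalIntegral.integral_eq_sub_of_hasDerivAt (f := fun t => Real.exp (l * |r| * t))]
        · simp
        · intro t _
          have := ((hasDerivAt_id t).const_mul (l * |r|)).exp
          simpa [mul_comm] using this
        · apply Continuous.intervalIntegrable; fun_prop
      rw [intervalIntegral.integral_const_mul] at h1 h2
      set I := ∫ t in (0:ℝ)..1, Real.exp (l * |r| * t) with hI
      have h3 : |r| * I ≤ Real.exp (l * |r|) / l := by
        rw [le_div_iff₀ hl0]; linarith
      push_cast
      calc |r| * _ ≤ |r| * (K * D * I) := mul_le_mul_of_nonneg_left h1 (abs_nonneg _)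
        _ = K * D * (|r| * I) := by ring
        _ ≤ K * D * (Real.exp (l * |r|) / l) := by
          apply mul_le_mul_of_nonneg_left h3; positivity
        _ = _ := by rw [← hl]; ring
  obtain ⟨w, hw⟩ : ∃ w, T w = w := ⟨_, hcon.fixedPoint_isFixedPt⟩
  refine ⟨fun r => Real.exp (l * |r|) * w r, ?_, ?_⟩
  · have := w.continuous
    fun_prop
  · intro r
    have := hT w r
    rw [hw] at this
    simp only
    rw [this, ← mul_assoc, ← Real.exp_add]
    simp

theorem cmp_nonneg (P P' : ℝ → ℝ) (R : ℝ) (h0 : 0 ≤ P 0) (hc : ContinuousOn P (Ico 0 R))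
    (hd : ∀ r ∈ Ioo 0 R, HasDerivAt P (P' r) r) (hs : ∀ r ∈ Ioo 0 R, P r < 0 → 0 ≤ P' r) :
    ∀ r ∈ Ico 0 R, 0 ≤ P r := by
  intro x hx
  by_contra hneg
  push Not at hneg
  have hcx : ContinuousOn P (Icc 0 x) := hc.mono fun y hy => ⟨hy.1, hy.2.trans_lt hx.2⟩
  have hcl : IsCompact (Icc 0 x ∩ P ⁻¹' Ici 0) :=
    isCompact_Icc.of_isClosed_subset (hcx.preimage_isClosed_of_isClosed isClosed_Icc isClosed_Ici)
      inter_subset_left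
  obtain ⟨t, ⟨htI, htP⟩, hmax⟩ := hcl.exists_isGreatest ⟨0, ⟨le_refl _, hx.1⟩, h0⟩
  have htP' : 0 ≤ P t := htP
  have hnegI : ∀ y ∈ Ioc t x, P y < 0 := by
    intro y hy
    by_contra hh
    push Not at hh
    have := hmax ⟨⟨htI.1.trans hy.1.le, hy.2⟩, hh⟩
    exact absurd hy.1 (not_lt.2 this)
  have hmono : MonotoneOn P (Icc t x) := by
    apply monotoneOn_of_deriv_nonneg (convex_Icc t x)
    · exact hcx.mono (Icc_subset_Icc htI.1 le_rfl)
    · intro y hy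
      rw [interior_Icc] at hy
      exact (hd y ⟨htI.1.trans_lt hy.1, hy.2.trans hx.2⟩).differentiableAt.differentiableWithinAt
    · intro y hy
      rw [interior_Icc] at hy
      have hy' : y ∈ Ioo 0 R := ⟨htI.1.trans_lt hy.1, hy.2.trans hx.2⟩
      rw [(hd y hy').deriv]
      exact hs y hy' (hnegI y ⟨hy.1, hy.2.le⟩)
  have := hmono ⟨le_rfl, htI.2⟩ ⟨htI.2, le_rfl⟩ htI.2
  linarith

theorem left_min_deriv (P : ℝ → ℝ) (p : ℝ) (h : ∀ r ∈ Ioo (0:ℝ) 1, 0 ≤ P r) (h1 : P 1 = 0)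
    (hd : HasDerivAt P p 1) : p ≤ 0 := by
  have h2 := (hasDerivWithinAt_iff_tendsto_slope' (by simp)).1 (hd.hasDerivWithinAt (s := Iio 1))
  refine le_of_tendsto h2 ?_
  filter_upwards [Ioo_mem_nhdsLT (show (0:ℝ) < 1 by norm_num)] with r hr
  rw [slope_def_field, h1, sub_zero]
  exact div_nonpos_of_nonneg_of_nonpos (h r hr) (by linarith [hr.2])

/-- The power of the cosine, as a function of the sine. -/
noncomputable def gfun (e x : ℝ) : ℝ := (Real.sqrt (1 - x ^ 2)) ^ e

theorem gfun_nonneg (e x : ℝ) : 0 ≤ gfun e x := Real.rpow_nonneg (Real.sqrt_nonneg _) _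

theorem gfun_pos (e x : ℝ) (h0 : 0 ≤ x) (h1 : x < 1) : 0 < gfun e x :=
  Real.rpow_pos_of_pos (Real.sqrt_pos.2 (by nlinarith)) _

theorem gfun_le_one {e : ℝ} (he : 0 < e) (x : ℝ) : gfun e x ≤ 1 := by
  apply Real.rpow_le_one (Real.sqrt_nonneg _) _ he.le
  rw [Real.sqrt_le_left zero_le_one]; nlinarith [sq_nonneg x]

theorem gfun_anti {e : ℝ} (he : 0 < e) {x y : ℝ} (h0 : 0 ≤ x) (h : x ≤ y) : gfun e y ≤ gfun e x := by
  apply Real.rpow_le_rpow (Real.sqrt_nonneg _) _ he.le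
  apply Real.sqrt_le_sqrt
  nlinarith

theorem gfun_cont {e : ℝ} (he : 0 < e) : Continuous (gfun e) := by
  unfold gfun
  apply Continuous.rpow_const (by fun_prop)
  intro x; right; exact he.le

theorem gfun_lip (e m : ℝ) (hm0 : 0 < m) (hm1 : m < 1) :
    ∃ K : NNReal, LipschitzWith K (fun x => gfun e (max 0 (min x m))) := by
  have h1 : ContDiffOn ℝ 1 (gfun e) (Icc 0 m) := by
    unfold gfun
    intro x hx
    have hx' : 0 < 1 - x ^ 2 := by nlinarith [hx.1, hx.2]
    apply ContDiffAt.contDiffWithinAt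
    apply ContDiffAt.rpow_const_of_ne
    · exact ContDiffAt.sqrt (f := fun x : ℝ => 1 - x ^ 2) (by fun_prop) hx'.ne'
    · exact (Real.sqrt_pos.2 hx').ne'
  obtain ⟨K, hK⟩ := h1.exists_lipschitzOnWith one_ne_zero (convex_Icc 0 m) isCompact_Icc
  refine ⟨K * 1, ?_⟩
  have h2 : LipschitzWith 1 (fun x : ℝ => max 0 (min x m)) :=
    (LipschitzWith.id.min_const m).const_max 0
  have h3 := hK.comp (h2.lipschitzOnWith (s := univ)) (fun x _ => ⟨le_max_left _ _, max_le hm0.le (min_le_right _ _)⟩)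
  exact lipschitzOnWith_univ.1 h3

/-- Solutions of the equation in the sine variable on `[0, R)`. -/
structure USol (d : ℕ) (e C R : ℝ) (u : ℝ → ℝ) : Prop where
  zero : u 0 = 0
  d0 : ∃ a, HasDerivWithinAt u a (Ici 0) 0
  lt : ∀ r ∈ Ioo 0 R, u r < 1
  der : ∀ r ∈ Ioo 0 R, HasDerivAt u (C * gfun e (u r) - d / r * u r) r

theorem USol.cont {d : ℕ} {e C R : ℝ} {u : ℝ → ℝ} (h : USol d e C R u) : ContinuousOn u (Ico 0 R) := by
  intro r hr
  rcases eq_or_lt_of_le hr.1 with h0 | h0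
  · subst h0
    obtain ⟨a, ha⟩ := h.d0
    exact ha.continuousWithinAt.mono Ico_subset_Ici_self
  · exact (h.der r ⟨h0, hr.2⟩).continuousAt.continuousWithinAt

theorem USol.pder {d : ℕ} (hd : 1 ≤ d) {e C R : ℝ} {u : ℝ → ℝ} (h : USol d e C R u) :
    ∀ r ∈ Ioo 0 R, HasDerivAt (fun r => r ^ d * u r) (r ^ d * (C * gfun e (u r))) r := by
  intro r hr
  obtain ⟨n, rfl⟩ : ∃ n, d = n + 1 := ⟨d - 1, by omega⟩
  have := (hasDerivAt_pow (n + 1) r).mul (h.der r hr)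
  refine this.congr_deriv ?_
  have := hr.1.ne'
  simp only [Nat.add_sub_cancel]
  field_simp
  ring

theorem USol.pcont {d : ℕ} {e C R : ℝ} {u : ℝ → ℝ} (h : USol d e C R u) :
    ContinuousOn (fun r => r ^ d * u r) (Ico 0 R) :=
  (continuous_pow d).continuousOn.mul h.cont

theorem USol.nonneg {d : ℕ} (hd : 1 ≤ d) {e C R : ℝ} {u : ℝ → ℝ} (hC : 0 ≤ C) (h : USol d e C R u) :
    ∀ r ∈ Ico 0 R, 0 ≤ u r := by
  intro r hr
  have := cmp_nonneg _ _ R (by simp [h.zero]) h.pcont (h.pder hd)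
    (fun r hr _ => mul_nonneg (pow_nonneg hr.1.le _) (mul_nonneg hC (gfun_nonneg _ _))) r hr
  rcases eq_or_lt_of_le hr.1 with h0 | h0
  · rw [← h0, h.zero]
  · exact (mul_nonneg_iff_of_pos_left (pow_pos h0 d)).1 this

theorem USol.le {d : ℕ} (hd : 1 ≤ d) {e C₁ C₂ R : ℝ} (he : 0 < e) {u₁ u₂ : ℝ → ℝ} (hC : 0 < C₁)
    (hCC : C₁ ≤ C₂) (h₁ : USol d e C₁ R u₁) (h₂ : USol d e C₂ R u₂) :
    ∀ r ∈ Ico 0 R, u₁ r ≤ u₂ r := by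
  intro r hr
  have := cmp_nonneg (fun r => r ^ d * u₂ r - r ^ d * u₁ r) _ R (by simp [h₁.zero, h₂.zero])
    (h₂.pcont.sub h₁.pcont) (fun r hr => (h₂.pder hd r hr).sub (h₁.pder hd r hr)) (by
      intro r hr hlt
      have hp := pow_pos hr.1 d
      rw [← mul_sub] at hlt ⊢
      have hlt' : u₂ r ≤ u₁ r := by nlinarith
      have hg := gfun_anti he (h₂.nonneg hd (hC.le.trans hCC) r ⟨hr.1.le, hr.2⟩) hlt'
      apply mul_nonneg hp.le
      have := gfun_nonneg e (u₁ r)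
      nlinarith) r hr
  rcases eq_or_lt_of_le hr.1 with h0 | h0
  · rw [← h0, h₁.zero, h₂.zero]
  · rw [← mul_sub] at this
    have := (mul_nonneg_iff_of_pos_left (pow_pos h0 d)).1 this
    linarith

theorem USol.not_lt {d : ℕ} (hd : 1 ≤ d) {e C₁ C₂ k : ℝ} (he : 0 < e) {u₁ u₂ : ℝ → ℝ} (hC : 0 < C₁)
    (h₁ : USol d e C₁ 2 u₁) (h₂ : USol d e C₂ 2 u₂) (e₁ : u₁ 1 = k) (e₂ : u₂ 1 = k) : ¬ C₁ < C₂ := by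
  intro hlt
  have hk1 : k < 1 := e₁ ▸ h₁.lt 1 (by norm_num)
  have hk0 : 0 ≤ k := e₁ ▸ h₁.nonneg hd hC.le 1 (by norm_num)
  have := left_min_deriv (fun r => r ^ d * u₂ r - r ^ d * u₁ r) _ (by
    intro r hr
    have h3 := h₁.le hd he hC hlt.le h₂ r ⟨hr.1.le, by linarith [hr.2]⟩
    have := pow_pos hr.1 d
    nlinarith) (by simp [e₁, e₂]) ((h₂.pder hd 1 (by norm_num)).sub (h₁.pder hd 1 (by norm_num)))
  rw [e₁, e₂] at this
  have hg := gfun_pos e k hk0 hk1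
  simp only [one_pow, one_mul] at this
  nlinarith

theorem USol.bound {d : ℕ} (hd : 1 ≤ d) {e C k : ℝ} (he : 0 < e) {u : ℝ → ℝ} (hC : 0 < C)
    (h : USol d e C 2 u) (hk : u 1 = k) : C * gfun e k < d + 1 := by
  by_contra hge
  push Not at hge
  have hk1 : k < 1 := hk ▸ h.lt 1 (by norm_num)
  have hk0 : 0 ≤ k := hk ▸ h.nonneg hd hC.le 1 (by norm_num)
  have hD : (0:ℝ) < d + 1 := by positivity
  have hder : ∀ r ∈ Ioo (0:ℝ) 2, HasDerivAt (fun r => r ^ d * u r - k * r ^ (d + 1))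
      (r ^ d * (C * gfun e (u r)) - k * ((d + 1) * r ^ d)) r := by
    intro r hr
    have := ((hasDerivAt_pow (d + 1) r).const_mul k)
    refine ((h.pder hd r hr).sub this).congr_deriv ?_
    push_cast
    simp
  have hc : ContinuousOn (fun r => r ^ d * u r - k * r ^ (d + 1)) (Ico 0 2) :=
    h.pcont.sub (by fun_prop)
  have hP := cmp_nonneg _ _ 1 (by simp [h.zero]) (hc.mono (Ico_subset_Ico le_rfl (by norm_num)))
    (fun r hr => hder r ⟨hr.1, by linarith [hr.2]⟩) (by
      intro r hr hlt
      have hp := pow_pos hr.1 d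
      have hlt' : u r ≤ k := by
        rw [pow_succ] at hlt
        have : u r - k * r < 0 := by nlinarith
        nlinarith [hr.2]
      have hg := gfun_anti he (h.nonneg hd hC.le r ⟨hr.1.le, by linarith [hr.2]⟩) hlt'
      have h1 : (d:ℝ) + 1 ≤ C * gfun e (u r) := hge.trans (mul_le_mul_of_nonneg_left hg hC.le)
      have h2 : k * (d + 1) ≤ d + 1 := by nlinarith
      nlinarith)
  have := left_min_deriv _ _ (fun r hr => hP r ⟨hr.1.le, hr.2⟩) (by simp [hk]) (hder 1 (by norm_num))
  rw [hk] at this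
  simp only [one_pow, one_mul, mul_one] at this
  nlinarith

theorem exists_barrier_s11 {e : ℝ} (he : 0 < e) (R : ℝ) : ∃ m, 0 < m ∧ m < 1 ∧ R * gfun e m ≤ m := by
  have hc : Continuous (fun x => x - R * gfun e x) := by
    have := gfun_cont he
    fun_prop
  have h1 : 0 < (fun x => x - R * gfun e x) 1 := by
    simp [gfun, Real.zero_rpow he.ne']
  have h2 : ∀ᶠ x in 𝓝[<] (1:ℝ), 0 < x - R * gfun e x :=
    (hc.continuousAt.eventually (lt_mem_nhds h1)).filter_mono nhdsWithin_le_nhds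
  obtain ⟨m, hm, hm'⟩ := (h2.and (Ioo_mem_nhdsLT (show (0:ℝ) < 1 by norm_num))).exists
  exact ⟨m, hm'.1, hm'.2, by linarith⟩

theorem exists_usol_local {d : ℕ} (hd : 1 ≤ d) {e : ℝ} (he : 0 < e) (R : ℝ) (hR : 0 < R) :
    ∃ u, USol d e 1 R u := by
  obtain ⟨m, hm0, hm1, hm⟩ := exists_barrier_s11 he R
  obtain ⟨K, hK⟩ := gfun_lip e m hm0 hm1
  set h : ℝ → ℝ := fun x => gfun e (max 0 (min x m)) with hh
  have hhc : Continuous h := hK.continuous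
  have hh0 : ∀ x, 0 ≤ h x := fun x => gfun_nonneg _ _
  obtain ⟨u, huc, hu⟩ := exists_volterra d h K hK
    (fun x => by rw [abs_of_nonneg (hh0 x)]; exact gfun_le_one he _)
  have hu0 : u 0 = 0 := by rw [hu]; simp
  have hint : ∀ r, 0 < r → r ^ d * u r = ∫ s in (0:ℝ)..r, s ^ d * h (u s) := by
    intro r hr
    have := intervalIntegral.mul_integral_comp_mul_left (a := 0) (b := 1) (f := fun s => s ^ d * h (u s)) (c := r)
    rw [mul_zero, mul_one] at this
    rw [← this, hu r, mul_left_comm, ← intervalIntegral.integral_const_mul]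
    congr 2
    ext t
    ring
  have hpd : ∀ r, 0 < r → HasDerivAt (fun r => r ^ d * u r) (r ^ d * h (u r)) r := by
    intro r hr
    have h1 : Continuous (fun s => s ^ d * h (u s)) := by fun_prop
    have h2 := intervalIntegral.integral_hasDerivAt_right (h1.intervalIntegrable 0 r)
      (h1.stronglyMeasurableAtFilter _ _) h1.continuousAt
    refine h2.congr_of_eventuallyEq ?_
    filter_upwards [lt_mem_nhds hr] with s hs
    exact hint s hs
  have hpc : Continuous (fun r => r ^ d * u r) := by fun_prop
  have hnn : ∀ r ∈ Ico 0 R, 0 ≤ u r := by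
    intro r hr
    rw [hu]
    apply mul_nonneg hr.1
    apply intervalIntegral.integral_nonneg zero_le_one
    intro t ht
    exact mul_nonneg (pow_nonneg ht.1 _) (hh0 _)
  have hle : ∀ r ∈ Ico 0 R, u r ≤ m := by
    intro r hr
    have := cmp_nonneg (fun r => m * r ^ d - r ^ d * u r) _ R (by simp [hu0, show d ≠ 0 by omega])
      (by fun_prop) (fun r hr => ((hasDerivAt_pow d r).const_mul m).sub (hpd r hr.1)) (by
        intro r hr hlt
        have hp := pow_pos hr.1 d
        have hlt' : m ≤ u r := by nlinarith
        have h1 : h (u r) = gfun e m := by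
          simp only [hh]
          rw [min_eq_right hlt', max_eq_right hm0.le]
        rw [h1]
        obtain ⟨n, rfl⟩ : ∃ n, d = n + 1 := ⟨d - 1, by omega⟩
        have hp' := pow_pos hr.1 n
        have h2 : r * gfun e m ≤ m :=
          (mul_le_mul_of_nonneg_right hr.2.le (gfun_nonneg _ _)).trans hm
        have h3 : (1:ℝ) ≤ ((n + 1 : ℕ) : ℝ) := by exact_mod_cast hd
        have h4 : m ≤ m * ((n + 1 : ℕ) : ℝ) := by nlinarith
        simp only [Nat.add_sub_cancel]
        have : m * (((n + 1 : ℕ) : ℝ) * r ^ n) - r ^ (n + 1) * gfun e m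
          = r ^ n * (m * ((n + 1 : ℕ) : ℝ) - r * gfun e m) := by ring
        rw [this]
        apply mul_nonneg hp'.le
        linarith) r hr
    rcases eq_or_lt_of_le hr.1 with h0 | h0
    · rw [← h0, hu0]; exact hm0.le
    · have hp := pow_pos h0 d
      nlinarith
  refine ⟨u, hu0, ?_, ?_, ?_⟩
  · refine ⟨∫ t in (0:ℝ)..1, t ^ d * h (u (0 * t)), HasDerivAt.hasDerivWithinAt ?_⟩
    rw [hasDerivAt_iff_tendsto_slope]
    have hcont : Continuous (fun r : ℝ => ∫ t in (0:ℝ)..1, t ^ d * h (u (r * t))) := by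
      apply intervalIntegral.continuous_parametric_intervalIntegral_of_continuous'
      simp only [Function.uncurry_def]
      fun_prop
    refine (hcont.tendsto 0).mono_left nhdsWithin_le_nhds |>.congr' ?_
    filter_upwards [self_mem_nhdsWithin] with r hr
    have hr' : r ≠ 0 := hr
    rw [slope_def_field, hu0, hu r]
    field_simp
    simp [mul_comm]
  · intro r hr
    exact (hle r ⟨hr.1.le, hr.2⟩).trans_lt hm1
  · intro r hr
    have hr0 := hr.1.ne'
    have h1 : h (u r) = gfun e (u r) := by
      simp only [hh]
      rw [min_eq_left (hle r ⟨hr.1.le, hr.2⟩), max_eq_right (hnn r ⟨hr.1.le, hr.2⟩)]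
    have h2 := (hpd r hr.1).div (hasDerivAt_pow d r) (pow_ne_zero d hr0)
    rw [h1] at h2
    refine (h2.congr_deriv ?_).congr_of_eventuallyEq ?_
    · obtain ⟨n, rfl⟩ : ∃ n, d = n + 1 := ⟨d - 1, by omega⟩
      simp only [Nat.add_sub_cancel]
      field_simp
      ring
    · filter_upwards [lt_mem_nhds hr.1] with s hs
      have := hs.ne'
      simp only [Pi.div_apply]
      field_simp

theorem exists_usol {d : ℕ} (hd : 1 ≤ d) {e : ℝ} (he : 0 < e) :
    ∃ u, ∀ R, USol d e 1 R u := by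
  choose! v hv using fun R (hR : 0 < R) => exists_usol_local hd he R hR
  have hR : ∀ n : ℕ, (0:ℝ) < n + 1 := fun n => by positivity
  have hmono : ∀ {R S : ℝ} {u : ℝ → ℝ}, R ≤ S → USol d e 1 S u → USol d e 1 R u := by
    intro R S u hRS hu
    exact ⟨hu.zero, hu.d0, fun r hr => hu.lt r ⟨hr.1, hr.2.trans_le hRS⟩,
      fun r hr => hu.der r ⟨hr.1, hr.2.trans_le hRS⟩⟩
  have huniq : ∀ R S, 0 < R → R ≤ S → ∀ r ∈ Ico 0 R, v R r = v S r := by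
    intro R S hR hRS r hr
    have h1 := hv R hR
    have h2 := hmono hRS (hv S (hR.trans_le hRS))
    exact le_antisymm (h1.le hd he one_pos le_rfl h2 r hr) (h2.le hd he one_pos le_rfl h1 r hr)
  let U : ℝ → ℝ := fun r => v (⌊r⌋₊ + 1) r
  have hU : ∀ n : ℕ, ∀ r ∈ Ico (0:ℝ) (n + 1), U r = v (n + 1) r := by
    intro n r hr
    apply huniq _ _ (hR _)
    · have : ⌊r⌋₊ < n + 1 := (Nat.floor_lt hr.1).2 (by exact_mod_cast hr.2)
      have : ((⌊r⌋₊ : ℕ) : ℝ) ≤ n := by exact_mod_cast Nat.lt_succ_iff.1 this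
      linarith
    · exact ⟨hr.1, Nat.lt_floor_add_one r⟩
  refine ⟨U, fun R => ⟨?_, ?_, ?_, ?_⟩⟩
  · rw [hU 0 0 (by simp)]; exact (hv _ (hR 0)).zero
  · obtain ⟨a, ha⟩ := (hv _ (hR 0)).d0
    refine ⟨a, ha.congr_of_eventuallyEq ?_ (hU 0 0 (by simp))⟩
    filter_upwards [Ico_mem_nhdsGE (show (0:ℝ) < 1 by norm_num)] with r hr
    exact hU 0 r (by simpa using hr)
  · intro r hr
    exact (hv _ (hR ⌊r⌋₊)).lt r ⟨hr.1, Nat.lt_floor_add_one r⟩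
  · intro r hr
    have hf := Nat.lt_floor_add_one r
    have h1 := (hv _ (hR ⌊r⌋₊)).der r ⟨hr.1, hf⟩
    refine h1.congr_of_eventuallyEq ?_
    filter_upwards [Ioo_mem_nhds hr.1 hf] with s hs
    exact hU _ s ⟨hs.1.le, hs.2⟩

theorem USol.reach {d : ℕ} (hd : 1 ≤ d) {e : ℝ} (he : 0 < e) {u : ℝ → ℝ}
    (h : ∀ R, USol d e 1 R u) {k : ℝ} (hk0 : 0 < k) (hk1 : k < 1) : ∃ C, 0 < C ∧ u C = k := by
  have hm := gfun_pos e k hk0.le hk1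
  set m := gfun e k with hmd
  have hex : ∃ R, 0 < R ∧ k ≤ u R := by
    by_contra hcon
    push Not at hcon
    have hR : 0 < (d + 1) * k / m := by positivity
    set R := (d + 1) * k / m with hRd
    have hc : ContinuousOn (fun r => r ^ d * u r - m / (d + 1) * r ^ (d + 1)) (Ico 0 (R + 1)) :=
      (h _).pcont.sub (by fun_prop)
    have := cmp_nonneg _ _ (R + 1) (by simp [(h R).zero]) hc
      (fun r hr => ((h _).pder hd r hr).sub ((hasDerivAt_pow (d + 1) r).const_mul (m / (d + 1)))) (by
        intro r hr _
        have hp := pow_pos hr.1 d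
        have hg := gfun_anti he ((h _).nonneg hd zero_le_one r ⟨hr.1.le, hr.2⟩) (hcon r hr.1).le
        simp only [Nat.add_sub_cancel]
        push_cast
        have : m / (d + 1) * ((d + 1) * r ^ d) = r ^ d * m := by field_simp
        rw [this, one_mul, ← mul_sub]
        apply mul_nonneg hp.le
        linarith) R ⟨hR.le, by linarith⟩
    have h2 : m / (d + 1) * R ^ (d + 1) = R ^ d * k := by
      rw [pow_succ, hRd]; field_simp
    rw [h2, ← mul_sub] at this
    have := (mul_nonneg_iff_of_pos_left (pow_pos hR d)).1 this
    linarith [hcon R hR]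
  obtain ⟨R, hR, hkR⟩ := hex
  have hc : ContinuousOn u (Icc 0 R) := (h (R + 1)).cont.mono fun x hx => ⟨hx.1, by linarith [hx.2]⟩
  obtain ⟨C, hC, hCk⟩ := intermediate_value_Icc hR.le hc (show k ∈ Icc (u 0) (u R) from ⟨by rw [(h R).zero]; exact hk0.le, hkR⟩)
  refine ⟨C, lt_of_le_of_ne hC.1 ?_, hCk⟩
  rintro rfl
  rw [(h R).zero] at hCk
  exact hk0.ne hCk

theorem sqrt_one_sub_sin (v : ℝ) :
    Real.sqrt (1 - (v / Real.sqrt (1 + v ^ 2)) ^ 2) = 1 / Real.sqrt (1 + v ^ 2) := by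
  have h1 : (0:ℝ) < 1 + v ^ 2 := by positivity
  have h2 : 1 - (v / Real.sqrt (1 + v ^ 2)) ^ 2 = (1 / Real.sqrt (1 + v ^ 2)) ^ 2 := by
    rw [div_pow, div_pow, Real.sq_sqrt h1.le]
    field_simp
    ring
  rw [h2, Real.sqrt_sq (by positivity)]

theorem sin_lt_one (v : ℝ) : v / Real.sqrt (1 + v ^ 2) < 1 := by
  have h1 : (0:ℝ) < 1 + v ^ 2 := by positivity
  rw [div_lt_one (Real.sqrt_pos.2 h1)]
  apply Real.lt_sqrt_of_sq_lt
  linarith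

theorem hasDerivAt_sin (v : ℝ) :
    HasDerivAt (fun v => v / Real.sqrt (1 + v ^ 2)) (1 / Real.sqrt (1 + v ^ 2) ^ 3) v := by
  have h1 : (0:ℝ) < 1 + v ^ 2 := by positivity
  have hs := Real.sqrt_pos.2 h1
  have hsq := Real.sq_sqrt h1.le
  have h2 := (((hasDerivAt_pow 2 v).const_add 1).sqrt h1.ne')
  refine ((hasDerivAt_id v).div h2 hs.ne').congr_deriv ?_
  simp only [id]
  set s := Real.sqrt (1 + v ^ 2)
  field_simp
  simp
  linarith

theorem hasDerivAt_tan (u : ℝ) (hu : 0 < 1 - u ^ 2) :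
    HasDerivAt (fun u => u / Real.sqrt (1 - u ^ 2)) (1 / Real.sqrt (1 - u ^ 2) ^ 3) u := by
  have hs := Real.sqrt_pos.2 hu
  have hsq := Real.sq_sqrt hu.le
  have h2 := (((hasDerivAt_pow 2 u).const_sub 1).sqrt hu.ne')
  refine ((hasDerivAt_id u).div h2 hs.ne').congr_deriv ?_
  simp only [id]
  set s := Real.sqrt (1 - u ^ 2)
  field_simp
  simp
  linarith

theorem oddPow_eq_s11 {c s e : ℝ} (hc : 0 < c) (hs : 0 < s) :
    oddPow (c / s - 0) e = c ^ e * (1 / s) ^ e := by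
  have : 0 ≤ c / s := by positivity
  rw [sub_zero, oddPow, if_pos this, ← Real.mul_rpow hc.le (by positivity), mul_one_div]

theorem profile_to_usol {d : ℕ} {α c : ℝ} (hc : 0 < c)
    {φ φ' φ'' : ℝ → ℝ} (h : IsProfileSolOn (d + 1) α 0 c (Ici 0) φ φ' φ'') (R : ℝ) :
    USol d (1 / α) (c ^ (1 / α)) R (fun r => φ' r / Real.sqrt (1 + φ' r ^ 2)) := by
  obtain ⟨-, h0, -, hd, heq⟩ := h
  refine ⟨by simp [h0], ?_, fun r _ => sin_lt_one _, ?_⟩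
  · exact ⟨_, (hasDerivAt_sin (φ' 0)).comp_hasDerivWithinAt 0 (hd 0 self_mem_Ici)⟩
  · intro r hr
    have h1 := (hasDerivAt_sin (φ' r)).comp r ((hd r hr.1.le).hasDerivAt (Ici_mem_nhds hr.1))
    refine h1.congr_deriv ?_
    have h2 := heq r hr.1.le hr.1.ne'
    have hp : (0:ℝ) < 1 + φ' r ^ 2 := by positivity
    have hs := Real.sqrt_pos.2 hp
    have hsq := Real.sq_sqrt hp.le
    rw [oddPow_eq_s11 hc hs] at h2
    rw [gfun, sqrt_one_sub_sin]
    set s := Real.sqrt (1 + φ' r ^ 2) with hsd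
    set G := c ^ (1 / α) * (1 / s) ^ (1 / α) with hG
    have hr0 := hr.1.ne'
    rw [← hsq] at h2
    push_cast at h2
    have h3 : G = (φ'' r / s ^ 2 + ((d:ℝ) + 1 - 1) / r * φ' r) / s := by
      rw [h2]; field_simp
    rw [h3]
    field_simp
    ring

theorem usol_to_profile {d : ℕ} (hd : 1 ≤ d) {α c : ℝ} (hc : 0 < c) {u : ℝ → ℝ}
    (h : ∀ R, USol d (1 / α) (c ^ (1 / α)) R u) :
    ∃ φ φ'', IsProfileSolOn (d + 1) α 0 c (Ici 0) φ (fun r => u r / Real.sqrt (1 - u r ^ 2)) φ'' := by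
  have hC : 0 < c ^ (1 / α) := Real.rpow_pos_of_pos hc _
  have hpos : ∀ r ∈ Ici (0:ℝ), 0 < 1 - u r ^ 2 := by
    intro r hr
    rcases eq_or_lt_of_le (show (0:ℝ) ≤ r from hr) with h0 | h0
    · rw [← h0, (h 0).zero]; norm_num
    · have h1 := (h (r + 1)).lt r ⟨h0, by linarith⟩
      have h2 := (h (r + 1)).nonneg hd hC.le r ⟨h0.le, by linarith⟩
      nlinarith
  set v : ℝ → ℝ := fun r => u r / Real.sqrt (1 - u r ^ 2) with hv
  have hder : ∀ r, 0 < r → HasDerivAt v (1 / Real.sqrt (1 - u r ^ 2) ^ 3 *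
      (c ^ (1 / α) * gfun (1 / α) (u r) - d / r * u r)) r := by
    intro r hr
    exact (hasDerivAt_tan (u r) (hpos r hr.le)).comp r ((h (r + 1)).der r ⟨hr, by linarith⟩)
  have hdiff : ∀ r ∈ Ici (0:ℝ), DifferentiableWithinAt ℝ v (Ici 0) r := by
    intro r hr
    rcases eq_or_lt_of_le (show (0:ℝ) ≤ r from hr) with h0 | h0
    · subst h0
      obtain ⟨a, ha⟩ := (h 0).d0
      exact ((hasDerivAt_tan (u 0) (hpos 0 hr)).comp_hasDerivWithinAt 0 ha).differentiableWithinAt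
    · exact (hder r h0).differentiableAt.differentiableWithinAt
  have hvc : ContinuousOn v (Ici 0) := fun r hr => (hdiff r hr).continuousWithinAt
  have hwc : Continuous (fun r => v (max r 0)) :=
    hvc.comp_continuous (by fun_prop) (fun r => le_max_right r 0)
  refine ⟨fun r => ∫ s in (0:ℝ)..r, v (max s 0), derivWithin v (Ici 0), by simp, ?_, ?_, ?_, ?_⟩
  · simp [hv, (h 0).zero]
  · intro r hr
    have h2 := intervalIntegral.integral_hasDerivAt_right (hwc.intervalIntegrable 0 r)
      (hwc.stronglyMeasurableAtFilter _ _) hwc.continuousAt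
    rw [max_eq_left (show (0:ℝ) ≤ r from hr)] at h2
    exact h2.hasDerivWithinAt
  · intro r hr
    exact (hdiff r hr).hasDerivWithinAt
  · intro r hr hr0
    have hr1 : 0 < r := lt_of_le_of_ne hr (Ne.symm hr0)
    rw [(hder r hr1).hasDerivWithinAt.derivWithin (uniqueDiffOn_Ici 0 r hr)]
    have hp := hpos r hr
    have hs := Real.sqrt_pos.2 hp
    have hsq := Real.sq_sqrt hp.le
    have hv1 : 1 + v r ^ 2 = (1 / Real.sqrt (1 - u r ^ 2)) ^ 2 := by
      simp only [hv]
      rw [div_pow, div_pow, hsq]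
      field_simp
      ring
    rw [hv1, Real.sqrt_sq (by positivity), oddPow_eq_s11 hc (by positivity), one_div_one_div]
    simp only [hv, gfun]
    set s := Real.sqrt (1 - u r ^ 2)
    push_cast
    field_simp
    ring

theorem USol.scale {d : ℕ} {e C : ℝ} (hC : 0 < C) {u : ℝ → ℝ} (h : ∀ R, USol d e 1 R u) (R : ℝ) :
    USol d e C R (fun r => u (C * r)) := by
  refine ⟨by simp [(h 0).zero], ?_, ?_, ?_⟩
  · obtain ⟨a, ha⟩ := (h 0).d0
    have h1 : HasDerivWithinAt (fun r : ℝ => C * r) (C * 1) (Ici 0) 0 :=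
      ((hasDerivAt_id (0:ℝ)).const_mul C).hasDerivWithinAt
    refine ⟨a * (C * 1), HasDerivWithinAt.comp (h₂ := u) (s' := Ici 0) 0 (by simpa using ha) h1 ?_⟩
    intro r hr
    exact mul_nonneg hC.le hr
  · intro r hr
    exact (h (C * r + 1)).lt _ ⟨mul_pos hC hr.1, by linarith⟩
  · intro r hr
    have h1 := (h (C * r + 1)).der (C * r) ⟨mul_pos hC hr.1, by linarith⟩
    have h2 : HasDerivAt (fun r : ℝ => C * r) (C * 1) r := (hasDerivAt_id r).const_mul C
    refine (HasDerivAt.comp (h₂ := u) r h1 h2).congr_deriv ?_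
    have := hr.1.ne'
    field_simp

/-- for `b = 0` and `k > 0` there is a unique speed `c̃ > 0` whose
translating profile satisfies `Φ'(1; c̃, 0) = k`; moreover `c̃ < N^α·√(1+k²)`. -/
theorem stmt11 (N : ℕ) (hN : 1 < N) (α k : ℝ) (hα : 0 < α) (hk : 0 < k) :
    ∃ ct : ℝ, 0 < ct ∧ ct < (N : ℝ) ^ α * Real.sqrt (1 + k ^ 2) ∧
      (∃ φ φ' φ'' : ℝ → ℝ,
        IsProfileSolOn N α 0 ct (Set.Ici 0) φ φ' φ'' ∧ φ' 1 = k) ∧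
      ∀ c : ℝ, 0 < c →
        (∃ φ φ' φ'' : ℝ → ℝ,
          IsProfileSolOn N α 0 c (Set.Ici 0) φ φ' φ'' ∧ φ' 1 = k) → c = ct := by
  obtain ⟨d, rfl⟩ : ∃ d, N = d + 1 := ⟨N - 1, by omega⟩
  have hd : 1 ≤ d := by omega
  have he : 0 < 1 / α := by positivity
  have hp : (0:ℝ) < 1 + k ^ 2 := by positivity
  have hs := Real.sqrt_pos.2 hp
  obtain ⟨u, hu⟩ := exists_usol hd he
  obtain ⟨C, hC, hCk⟩ := USol.reach hd he hu (k := k / Real.sqrt (1 + k ^ 2)) (by positivity)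
    (sin_lt_one k)
  have hCe : (C ^ α) ^ (1 / α) = C := by
    rw [← Real.rpow_mul hC.le, mul_one_div_cancel hα.ne', Real.rpow_one]
  have hct : 0 < C ^ α := Real.rpow_pos_of_pos hC _
  have hsol : ∀ R, USol d (1 / α) C R (fun r => u (C * r)) := USol.scale hC hu
  have h1 : (fun r => u (C * r)) 1 = k / Real.sqrt (1 + k ^ 2) := by simp [hCk]
  refine ⟨C ^ α, hct, ?_, ?_, ?_⟩
  · have hb := (hsol 2).bound hd he hC h1
    rw [gfun, sqrt_one_sub_sin, Real.div_rpow zero_le_one hs.le, Real.one_rpow, mul_one_div,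
      div_lt_iff₀ (Real.rpow_pos_of_pos hs _)] at hb
    have h2 := Real.rpow_lt_rpow hC.le hb hα
    rw [Real.mul_rpow (by positivity) (by positivity), ← Real.rpow_mul hs.le,
      one_div_mul_cancel hα.ne', Real.rpow_one] at h2
    push_cast
    exact h2
  · obtain ⟨φ, φ'', hφ⟩ := usol_to_profile hd hct (u := fun r => u (C * r)) (by rw [hCe]; exact hsol)
    refine ⟨φ, _, φ'', hφ, ?_⟩
    simp only [mul_one, hCk]
    rw [sqrt_one_sub_sin]
    field_simp
  · rintro c hc ⟨φ, φ', φ'', hφ, hφ1⟩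
    have h3 := profile_to_usol hc hφ 2
    have h4 : (fun r => φ' r / Real.sqrt (1 + φ' r ^ 2)) 1 = k / Real.sqrt (1 + k ^ 2) := by
      simp only [hφ1]
    have h5 := h3.not_lt hd he (Real.rpow_pos_of_pos hc _) (hsol 2) h4 h1
    have h6 := (hsol 2).not_lt hd he hC h3 h1 h4
    have h7 : c ^ (1 / α) = C := le_antisymm (not_lt.1 h6) (not_lt.1 h5)
    rw [← h7, ← Real.rpow_mul hc.le, one_div_mul_cancel hα.ne', Real.rpow_one]
end
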